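/- arXiv:2204.05935 — 4 statements merged into one kernel-verified Lean document; each statement's English description precedes it below -/
import Mathlib

section
/- Let v be a permutation of {1,…,n} and let g ∈ SL(n,ℝ) satisfy g·v̇⁻¹ ∈ N and v̇⁻¹·g ∈ N. Then every right-aligned flag minor of g is nonnegative if and only if every top-aligned flag minor of g is nonnegative. -/
open Matrix Finset

namespace Paper

open scoped Classical

noncomputable section

variable {K : Type*} [Field K] {n m : ℕ}

/-- `N`: upper unitriangular matrices. -/
def IsN (g : Matrix (Fin n) (Fin n) K) : Prop :=
  (∀ i, g i i = 1) ∧ ∀ i j : Fin n, j < i → g i j = 0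

/-- `N₋`: lower unitriangular matrices. -/
def IsNm (g : Matrix (Fin n) (Fin n) K) : Prop :=
  (∀ i, g i i = 1) ∧ ∀ i j : Fin n, i < j → g i j = 0

/-- `B`: upper triangular matrices of determinant 1. -/
def IsB (g : Matrix (Fin n) (Fin n) K) : Prop :=
  g.det = 1 ∧ ∀ i j : Fin n, j < i → g i j = 0

/-- `B₋`: lower triangular matrices of determinant 1. -/
def IsBm (g : Matrix (Fin n) (Fin n) K) : Prop :=
  g.det = 1 ∧ ∀ i j : Fin n, i < j → g i j = 0

/-- `H`: diagonal matrices of determinant 1. -/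
def IsH (g : Matrix (Fin n) (Fin n) K) : Prop :=
  g.det = 1 ∧ ∀ i j : Fin n, i ≠ j → g i j = 0

/-- UDL factorization: `g = yp * y0 * ym` with `yp ∈ N`, `y0 ∈ H`, `ym ∈ N₋`. -/
def UDL (g yp y0 ym : Matrix (Fin n) (Fin n) K) : Prop :=
  IsN yp ∧ IsH y0 ∧ IsNm ym ∧ g = yp * y0 * ym

/-- LDU factorization: `g = zm * z0 * zp` with `zm ∈ N₋`, `z0 ∈ H`, `zp ∈ N`. -/
def LDU (g zm z0 zp : Matrix (Fin n) (Fin n) K) : Prop :=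
  IsNm zm ∧ IsH z0 ∧ IsN zp ∧ g = zm * z0 * zp

/-- The signed permutation matrix `v̇`. -/
def pdot (v : Equiv.Perm (Fin n)) : Matrix (Fin n) (Fin n) K :=
  Matrix.of fun a b : Fin n =>
    if a = v b then
      (-1 : K) ^ (univ.filter fun k : Fin n => b < k ∧ v k < v b).card
    else 0

/-- Membership in the double coset `B₋ w B₋`. -/
def InBmWBm (w : Equiv.Perm (Fin n)) (g : Matrix (Fin n) (Fin n) K) : Prop :=
  ∃ b₁ b₂ : Matrix (Fin n) (Fin n) K, IsBm b₁ ∧ IsBm b₂ ∧ g = b₁ * pdot w * b₂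

/-- `Δ^I_J(g)`: the minor with row set `I` and column set `J` (junk value 0 if sizes differ). -/
def minor (g : Matrix (Fin n) (Fin n) K) (I J : Finset (Fin n)) : K :=
  if h : I.card = J.card then
    Matrix.det (Matrix.of fun a b : Fin I.card =>
      g (I.orderEmbOfFin rfl a) (J.orderEmbOfFin h.symm b))
  else 0

/-- All right-aligned flag minors of `g` are nonnegative. -/
def RightFlagNonneg (g : Matrix (Fin n) (Fin n) ℝ) : Prop :=
  ∀ I : Finset (Fin n),
    0 ≤ minor g I (univ.filter fun j : Fin n => n - I.card ≤ (j : ℕ))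

/-- All top-aligned flag minors of `g` are nonnegative. -/
def TopFlagNonneg (g : Matrix (Fin n) (Fin n) ℝ) : Prop :=
  ∀ J : Finset (Fin n),
    0 ≤ minor g (univ.filter fun i : Fin n => (i : ℕ) < J.card) J

/-- `x_i(t)` (with 1-based `i`): `Id + t·E_{i,i+1}`. -/
def xmat (i : ℕ) (t : K) : Matrix (Fin n) (Fin n) K :=
  Matrix.of fun a b : Fin n =>
    if a = b then 1 else if (a : ℕ) + 1 = i ∧ (b : ℕ) = i then t else 0

/-- `y_i(t)` (with 1-based `i`): `Id + t·E_{i+1,i}`. -/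
def ymat (i : ℕ) (t : K) : Matrix (Fin n) (Fin n) K :=
  Matrix.of fun a b : Fin n =>
    if a = b then 1 else if (a : ℕ) = i ∧ (b : ℕ) + 1 = i then t else 0

/-- `ṡ_i` (with 1-based `i`). -/
def sdot (i : ℕ) : Matrix (Fin n) (Fin n) K :=
  Matrix.of fun a b : Fin n =>
    if (a : ℕ) + 1 = i ∧ (b : ℕ) = i then 1
    else if (a : ℕ) = i ∧ (b : ℕ) + 1 = i then -1
    else if a = b ∧ (a : ℕ) + 1 ≠ i ∧ (a : ℕ) ≠ i then 1
    else 0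

/-- The adjacent transposition `s_i` (with 1-based `i`); identity if out of range. -/
def sperm (n : ℕ) (i : ℕ) : Equiv.Perm (Fin n) :=
  if h : i < n then
    Equiv.swap ⟨i - 1, Nat.lt_of_le_of_lt (Nat.sub_le i 1) h⟩ ⟨i, h⟩
  else 1

/-- `ℓ(w)`: the number of inversions of `w`. -/
def len (w : Equiv.Perm (Fin n)) : ℕ :=
  (univ.filter fun p : Fin n × Fin n => p.1 < p.2 ∧ w p.2 < w p.1).card

/-- `vseq ii v k = v_{(m-k)}`: the rightmost (positive distinguished) subexpression recursion. -/
def vseq (ii : Fin m → ℕ) (v : Equiv.Perm (Fin n)) : ℕ → Equiv.Perm (Fin n)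
  | 0 => v
  | k + 1 =>
    if h : m - k - 1 < m then
      if len (vseq ii v k * sperm n (ii ⟨m - k - 1, h⟩)) < len (vseq ii v k) then
        vseq ii v k * sperm n (ii ⟨m - k - 1, h⟩)
      else vseq ii v k
    else vseq ii v k

/-- `r ∈ J°` (0-based `r`, corresponding to the 1-based index `r+1`). -/
def inJ (ii : Fin m → ℕ) (v : Equiv.Perm (Fin n)) (r : Fin m) : Prop :=
  vseq ii v (m - (r : ℕ)) = vseq ii v (m - (r : ℕ) - 1)

/-- The list `[s_{i_1}, …, s_{i_m}]` of adjacent transpositions. -/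
def sPermList (n : ℕ) (ii : Fin m → ℕ) : List (Equiv.Perm (Fin n)) :=
  List.ofFn fun r => sperm n (ii r)

/-- The list `[s^v_{i_1}, …, s^v_{i_m}]`. -/
def svPermList (ii : Fin m → ℕ) (v : Equiv.Perm (Fin n)) : List (Equiv.Perm (Fin n)) :=
  List.ofFn fun r => if inJ ii v r then 1 else sperm n (ii r)

/-- The factors `g_1, …, g_m` of the Marsh–Rietsch element. -/
def mrgList (ii : Fin m → ℕ) (v : Equiv.Perm (Fin n)) (t : Fin m → K) :
    List (Matrix (Fin n) (Fin n) K) :=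
  List.ofFn fun r => if inJ ii v r then xmat (ii r) (t r) else sdot (ii r)

/-- The Marsh–Rietsch element `g = g_1 ⋯ g_m`. -/
def mrg (ii : Fin m → ℕ) (v : Equiv.Perm (Fin n)) (t : Fin m → K) :
    Matrix (Fin n) (Fin n) K :=
  (mrgList ii v t).prod

/-- The list `[ṡ_{i_1}, …, ṡ_{i_m}]`. -/
def sdotList (n : ℕ) (ii : Fin m → ℕ) : List (Matrix (Fin n) (Fin n) K) :=
  List.ofFn fun r => sdot (ii r)

/-- `ẇ = ṡ_{i_1} ⋯ ṡ_{i_m}`. -/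
def wMR (n : ℕ) (ii : Fin m → ℕ) : Matrix (Fin n) (Fin n) K :=
  (sdotList n ii).prod


theorem ins_emb {n k : ℕ} (S : Finset (Fin n)) (a : Fin n) (ha : a ∉ S) (hS : S.card = k)
    (hS' : (insert a S).card = k + 1) :
    ∃ p : Fin (k + 1), (p : ℕ) = (S.filter fun s => s < a).card ∧
      (insert a S).orderEmbOfFin hS' p = a ∧
      ∀ q, (insert a S).orderEmbOfFin hS' (p.succAbove q) = S.orderEmbOfFin hS q := by
  set e := (insert a S).orderEmbOfFin hS' with he
  have hmem : a ∈ Set.range e := by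
    rw [he, range_orderEmbOfFin]; simp
  obtain ⟨p, hp⟩ := hmem
  refine ⟨p, ?_, hp, ?_⟩
  · have h1 : (S.filter fun s => s < a) = (Finset.Iio p).map e.toEmbedding := by
      ext x
      simp only [mem_filter, mem_map, mem_Iio, RelEmbedding.coe_toEmbedding]
      constructor
      · rintro ⟨hx, hxa⟩
        have : x ∈ Set.range e := by
          rw [he, range_orderEmbOfFin]; simp [hx]
        obtain ⟨q, rfl⟩ := this
        refine ⟨q, ?_, rfl⟩
        rw [← hp] at hxa
        exact e.lt_iff_lt.1 hxa
      · rintro ⟨q, hq, rfl⟩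
        have h2 : e q < a := by rw [← hp]; exact e.lt_iff_lt.2 hq
        have h3 : e q ∈ insert a S := orderEmbOfFin_mem _ _ _
        rw [mem_insert] at h3
        rcases h3 with h3 | h3
        · exact absurd h3 h2.ne
        · exact ⟨h3, h2⟩
    rw [h1, card_map, Fin.card_Iio]
  · have := orderEmbOfFin_unique hS (f := fun q => e (p.succAbove q)) ?_ ?_
    · intro q; exact congrFun this q
    · intro q
      have h3 : e (p.succAbove q) ∈ insert a S := orderEmbOfFin_mem _ _ _
      rw [mem_insert] at h3
      rcases h3 with h3 | h3
      · rw [← hp] at h3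
        exact absurd (e.injective h3) (Fin.succAbove_ne p q)
      · exact h3
    · exact e.strictMono.comp (Fin.strictMono_succAbove p)

theorem minor_eq {n k : ℕ} (g : Matrix (Fin n) (Fin n) ℝ) (I J : Finset (Fin n))
    (hI : I.card = k) (hJ : J.card = k) :
    minor g I J = (g.submatrix (I.orderEmbOfFin hI) (J.orderEmbOfFin hJ)).det := by
  subst hI
  unfold minor
  rw [dif_pos hJ.symm]
  rfl

theorem minor_empty {n : ℕ} (g : Matrix (Fin n) (Fin n) ℝ) : minor g ∅ ∅ = 1 := by
  rw [minor_eq (k := 0) g ∅ ∅ rfl rfl]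
  simp

theorem minor_insert_row {n : ℕ} (g : Matrix (Fin n) (Fin n) ℝ) (I J : Finset (Fin n))
    (r c : Fin n) (hr : r ∉ I) (hc : c ∉ J) (hcard : I.card = J.card)
    (hz : ∀ j ∈ J, g r j = 0) :
    minor g (insert r I) (insert c J) =
      (-1) ^ ((I.filter fun s => s < r).card + (J.filter fun s => s < c).card) *
        g r c * minor g I J := by
  have hI : (insert r I).card = I.card + 1 := card_insert_of_notMem hr
  have hJ : (insert c J).card = I.card + 1 := by rw [card_insert_of_notMem hc, hcard]
  obtain ⟨p, hp, hp1, hp2⟩ := ins_emb I r hr rfl hI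
  obtain ⟨q, hq, hq1, hq2⟩ := ins_emb J c hc hcard.symm hJ
  rw [minor_eq g _ _ hI hJ, minor_eq g I J rfl hcard.symm, det_succ_row _ p,
    Finset.sum_eq_single q]
  · rw [hp, hq]
    simp only [submatrix_apply, hp1, hq1]
    congr 2
    ext a b
    simp only [submatrix_apply, hp2, hq2]
  · intro b _ hb
    obtain ⟨b', rfl⟩ := Fin.exists_succAbove_eq hb
    simp only [submatrix_apply, hp1, hq2]
    rw [hz _ (orderEmbOfFin_mem _ _ _)]
    simp
  · simp

theorem minor_insert_col {n : ℕ} (g : Matrix (Fin n) (Fin n) ℝ) (I J : Finset (Fin n))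
    (r c : Fin n) (hr : r ∉ I) (hc : c ∉ J) (hcard : I.card = J.card)
    (hz : ∀ i ∈ I, g i c = 0) :
    minor g (insert r I) (insert c J) =
      (-1) ^ ((I.filter fun s => s < r).card + (J.filter fun s => s < c).card) *
        g r c * minor g I J := by
  have hI : (insert r I).card = I.card + 1 := card_insert_of_notMem hr
  have hJ : (insert c J).card = I.card + 1 := by rw [card_insert_of_notMem hc, hcard]
  obtain ⟨p, hp, hp1, hp2⟩ := ins_emb I r hr rfl hI
  obtain ⟨q, hq, hq1, hq2⟩ := ins_emb J c hc hcard.symm hJ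
  rw [minor_eq g _ _ hI hJ, minor_eq g I J rfl hcard.symm, det_succ_column _ q,
    Finset.sum_eq_single p]
  · rw [hp, hq]
    simp only [submatrix_apply, hp1, hq1]
    congr 2
    ext a b
    simp only [submatrix_apply, hp2, hq2]
  · intro b _ hb
    obtain ⟨b', rfl⟩ := Fin.exists_succAbove_eq hb
    simp only [submatrix_apply, hp2, hq1]
    rw [hz _ (orderEmbOfFin_mem _ _ _)]
    simp
  · simp

/-- Row and column scaling. -/
theorem minor_scale {n : ℕ} (g : Matrix (Fin n) (Fin n) ℝ) (ρ κ : Fin n → ℝ)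
    (I J : Finset (Fin n)) (hcard : I.card = J.card) :
    minor (Matrix.of fun i j => ρ i * g i j * κ j) I J =
      (∏ i ∈ I, ρ i) * minor g I J * ∏ j ∈ J, κ j := by
  rw [minor_eq _ I J rfl hcard.symm, minor_eq g I J rfl hcard.symm]
  have h1 : (Matrix.submatrix (Matrix.of fun i j => ρ i * g i j * κ j) (I.orderEmbOfFin rfl)
      (J.orderEmbOfFin hcard.symm)) =
      Matrix.diagonal (fun a => ρ (I.orderEmbOfFin rfl a)) *
        g.submatrix (I.orderEmbOfFin rfl) (J.orderEmbOfFin hcard.symm) *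
        Matrix.diagonal (fun a => κ (J.orderEmbOfFin hcard.symm a)) := by
    ext a b
    simp [Matrix.mul_diagonal, Matrix.diagonal_mul]
  rw [h1, det_mul, det_mul, det_diagonal, det_diagonal]
  have h2 : ∏ i ∈ I, ρ i = ∏ a, ρ (I.orderEmbOfFin rfl a) := by
    conv_lhs => rw [← map_orderEmbOfFin_univ I rfl]
    rw [prod_map]; rfl
  have h3 : ∏ i ∈ J, κ i = ∏ a, κ (J.orderEmbOfFin hcard.symm a) := by
    conv_lhs => rw [← map_orderEmbOfFin_univ J hcard.symm]
    rw [prod_map]; rfl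
  rw [h2, h3]

/-- vector Plücker relation -/
theorem plucker_vec {m : ℕ} (T : Fin m → (Fin (m + 2) → ℝ)) (a b c d : Fin (m + 2) → ℝ)
    (F : (Fin (m + 2) → ℝ) → (Fin (m + 2) → ℝ) → ℝ)
    (hF : ∀ x y, F x y = (Matrix.of (Fin.cons x (Fin.cons y T : Fin (m + 1) → _) :
      Fin (m + 2) → (Fin (m + 2) → ℝ))).det) :
    F a b * F c d = F a c * F b d - F a d * F b c := by
  have hlin : ∀ (w : Fin (m + 2) → ℝ) (x : Fin (m + 2) → (Fin (m + 2) → ℝ))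
      (s : Fin (m + 2) → ℝ), F (∑ i, s i • x i) w = ∑ i, s i * F (x i) w := by
    intro w x s
    have h : ∀ y, F y w = (Matrix.detRowAlternating (R := ℝ) (n := Fin (m+2))).toMultilinearMap.toLinearMap
        (Fin.cons 0 (Fin.cons w T : Fin (m + 1) → _)) 0 y := by
      intro y
      rw [hF, MultilinearMap.toLinearMap_apply, Fin.update_cons_zero]
      rfl
    simp only [h, map_sum, map_smul, smul_eq_mul]
  have hanti : ∀ x y, F x y = - F y x := by
    intro x y
    rw [hF, hF]
    have h := Matrix.det_permute (Equiv.swap (0 : Fin (m+2)) 1)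
      (Matrix.of (Fin.cons y (Fin.cons x T : Fin (m + 1) → _) : Fin (m + 2) → (Fin (m + 2) → ℝ)))
    rw [Equiv.Perm.sign_swap (by simp)] at h
    have h2 : (Matrix.of (Fin.cons y (Fin.cons x T : Fin (m + 1) → _) :
        Fin (m + 2) → (Fin (m + 2) → ℝ))).submatrix (Equiv.swap (0 : Fin (m+2)) 1) id =
        (Matrix.of (Fin.cons x (Fin.cons y T : Fin (m + 1) → _) :
          Fin (m + 2) → (Fin (m + 2) → ℝ))) := by
      ext i j
      refine Fin.cases ?_ (fun i => ?_) i
      · simp [Equiv.swap_apply_left]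
      · refine Fin.cases ?_ (fun i => ?_) i
        · have : (Fin.succ 0 : Fin (m+2)) = 1 := rfl
          rw [this]
          simp [Equiv.swap_apply_right]
        · rw [submatrix_apply, Equiv.swap_apply_of_ne_of_ne]
          · simp
          · exact Fin.succ_ne_zero _
          · intro h
            have h' := congrArg Fin.val h
            simp at h'
    rw [h2] at h
    rw [h]; simp
  set M : Matrix (Fin (m+2)) (Fin (m+2)) ℝ :=
    Matrix.of (Fin.cons c (Fin.cons d T : Fin (m + 1) → _) : Fin (m + 2) → (Fin (m + 2) → ℝ)) with hM
  have hcr := Matrix.mulVec_cramer Mᵀ a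
  rw [det_transpose] at hcr
  have hexp : F c d • a = ∑ i, (M.updateRow i a).det • M i := by
    rw [hF c d, ← hM, ← hcr]
    ext j
    simp only [mulVec, dotProduct, transpose_apply, cramer_transpose_apply, Finset.sum_apply,
      Pi.smul_apply, smul_eq_mul]
    exact Finset.sum_congr rfl fun i _ => mul_comm _ _
  have hsum := hlin b (fun i => M i) (fun i => (M.updateRow i a).det)
  rw [← hexp] at hsum
  have hsm : F (F c d • a) b = F c d * F a b := by
    have := hlin b (fun i => if i = 0 then a else 0) (fun i => if i = 0 then F c d else 0)
    simpa using this
  rw [hsm, Fin.sum_univ_succ, Fin.sum_univ_succ] at hsum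
  have e0 : M 0 = c := rfl
  have e1 : M (Fin.succ 0) = d := rfl
  have e2 : ∀ i : Fin m, M (Fin.succ (Fin.succ i)) = T i := fun i => rfl
  have u0 : (M.updateRow 0 a).det = F a d := by
    rw [hF]; congr 1
    ext i j
    refine Fin.cases ?_ (fun i => ?_) i
    · rw [updateRow_self]; rfl
    · rw [updateRow_ne (Fin.succ_ne_zero _)]; rfl
  have u1 : (M.updateRow (Fin.succ 0) a).det = F c a := by
    rw [hF]; congr 1
    ext i j
    refine Fin.cases ?_ (fun i => ?_) i
    · rw [updateRow_ne (Fin.succ_ne_zero _).symm]; rfl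
    · refine Fin.cases ?_ (fun i => ?_) i
      · rw [updateRow_self]; rfl
      · rw [updateRow_ne]
        · rfl
        · intro h
          exact Fin.succ_ne_zero _ (Fin.succ_injective _ h)
  have z : ∀ i : Fin m, F (T i) b = 0 := by
    intro i
    rw [hF]
    apply Matrix.det_zero_of_row_eq (i := 0) (j := Fin.succ (Fin.succ i))
    · exact (Fin.succ_ne_zero _).symm
    · rfl
  simp only [e0, e1, e2, u0, u1, z, mul_zero, Finset.sum_const_zero, add_zero] at hsum
  rw [hanti b d, hanti b c, hanti a c]
  linarith [hsum]

theorem det_cons_sort {n k : ℕ} (g : Matrix (Fin n) (Fin n) ℝ) (r : Fin (k + 1) → Fin n)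
    (S : Finset (Fin n)) (a : Fin n) (ha : a ∉ S) (hS : S.card = k)
    (hS' : (insert a S).card = k + 1) :
    (g.submatrix r ((insert a S).orderEmbOfFin hS')).det =
      (-1) ^ (S.filter fun s => s < a).card *
        (g.submatrix r (Fin.cons a (S.orderEmbOfFin hS) : Fin (k + 1) → Fin n)).det := by
  obtain ⟨p, hp, hp1, hp2⟩ := ins_emb S a ha hS hS'
  rw [det_succ_column _ p, det_succ_column _ 0, Finset.mul_sum]
  refine Finset.sum_congr rfl fun i _ => ?_
  rw [← hp]
  simp only [submatrix_apply, hp1, submatrix_submatrix]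
  have h1 : (⇑((insert a S).orderEmbOfFin hS') ∘ p.succAbove) = S.orderEmbOfFin hS := by
    ext q; simp [hp2]
  have h2 : ((Fin.cons a (S.orderEmbOfFin hS) : Fin (k + 1) → Fin n) ∘ (0 : Fin (k+1)).succAbove)
      = S.orderEmbOfFin hS := by
    ext q; simp
  rw [h1, h2]
  simp only [Fin.cons_zero, Fin.val_zero, add_zero, pow_add]
  ring

theorem det_cons_cons_sort {n k : ℕ} (g : Matrix (Fin n) (Fin n) ℝ) (r : Fin (k + 2) → Fin n)
    (S : Finset (Fin n)) (a b : Fin n) (hb : b ∉ S) (hS : S.card = k)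
    (hS' : (insert b S).card = k + 1) :
    (g.submatrix r (Fin.cons a ((insert b S).orderEmbOfFin hS') : Fin (k + 2) → Fin n)).det =
      (-1) ^ (S.filter fun s => s < b).card *
        (g.submatrix r (Fin.cons a (Fin.cons b (S.orderEmbOfFin hS) : Fin (k + 1) → Fin n) :
          Fin (k + 2) → Fin n)).det := by
  rw [det_succ_column _ 0, det_succ_column _ 0, Finset.mul_sum]
  refine Finset.sum_congr rfl fun i _ => ?_
  simp only [submatrix_submatrix]
  have h2 : ∀ f : Fin (k + 1) → Fin n, ((Fin.cons a f : Fin (k + 2) → Fin n) ∘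
      (0 : Fin (k+2)).succAbove) = f := by
    intro f; ext q; simp
  rw [h2, h2, det_cons_sort g _ S b hb hS hS']
  simp only [submatrix_apply, Fin.cons_zero]
  ring

/-- determinant with two leading vectors -/
def FF {n m : ℕ} (g : Matrix (Fin n) (Fin n) ℝ) (r : Fin (m + 2) → Fin n) (t : Fin m → Fin n)
    (x y : Fin (m + 2) → ℝ) : ℝ :=
  (Matrix.of (Fin.cons x (Fin.cons y (fun q i => g (r i) (t q)) : Fin (m + 1) → _) :
      Fin (m + 2) → (Fin (m + 2) → ℝ))).det

theorem minor_two {n m : ℕ} (g : Matrix (Fin n) (Fin n) ℝ) (I T : Finset (Fin n))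
    (hT : T.card = m) (hI : I.card = m + 2) (a b : Fin n) (ha : a ∉ T) (hb : b ∉ T) (hab : a < b) :
    minor g I (insert a (insert b T)) =
      (-1) ^ (T.filter fun s => s < a).card * (-1) ^ (T.filter fun s => s < b).card *
      FF g (I.orderEmbOfFin hI) (T.orderEmbOfFin hT) (fun i => g (I.orderEmbOfFin hI i) a)
        (fun i => g (I.orderEmbOfFin hI i) b) := by
  have hbT : (insert b T).card = m + 1 := by rw [card_insert_of_notMem hb, hT]
  have haT : a ∉ insert b T := by simp [ha, hab.ne]
  have habT : (insert a (insert b T)).card = m + 1 + 1 := by rw [card_insert_of_notMem haT, hbT]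
  rw [minor_eq g I _ hI habT, det_cons_sort g _ _ a haT hbT habT, det_cons_cons_sort g _ T a b hb hT hbT]
  have h1 : ((insert b T).filter fun s => s < a) = T.filter fun s => s < a := by
    rw [filter_insert, if_neg (not_lt.2 hab.le)]
  rw [h1, ← mul_assoc]
  congr 1
  rw [FF, ← det_transpose]
  congr 1
  ext i j
  refine Fin.cases ?_ (fun i => ?_) i
  · simp
  · refine Fin.cases ?_ (fun i => ?_) i
    · simp
    · simp

theorem minor_one {n m : ℕ} (g : Matrix (Fin n) (Fin n) ℝ) (I T : Finset (Fin n)) (ρ : Fin n)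
    (hT : T.card = m) (hI : I.card = m + 1) (hρ : ∀ i ∈ I, i < ρ)
    (hI' : (insert ρ I).card = m + 2) (a : Fin n) (ha : a ∉ T) :
    minor g I (insert a T) =
      (-1) ^ (T.filter fun s => s < a).card * ((-1) ^ (m + 1) *
      FF g ((insert ρ I).orderEmbOfFin hI') (T.orderEmbOfFin hT)
        (fun i => if i = Fin.last _ then 1 else 0)
        (fun i => g ((insert ρ I).orderEmbOfFin hI' i) a)) := by
  have haT : (insert a T).card = m + 1 := by rw [card_insert_of_notMem ha, hT]
  obtain ⟨p, hp, hp1, hp2⟩ := ins_emb I ρ (fun h => lt_irrefl _ (hρ _ h)) hI hI'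
  have hpl : p = Fin.last _ := by
    ext
    rw [hp, filter_true_of_mem hρ, hI]; rfl
  subst hpl
  rw [minor_eq g I _ hI haT, det_cons_sort g _ _ a ha hT haT]
  congr 1
  rw [FF, det_succ_row (n := m + 1) _ 0, Finset.sum_eq_single (Fin.last _)]
  · simp only [of_apply, Fin.cons_zero, if_true, mul_one, Fin.val_zero, zero_add, Fin.val_last]
    rw [← mul_assoc, ← pow_add, ← two_mul, pow_mul]
    simp only [even_two, Even.neg_pow, one_pow, one_mul]
    rw [← det_transpose]
    congr 1
    ext i j
    have := hp2 j
    refine Fin.cases ?_ (fun i => ?_) i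
    · simp [← hp2]
    · simp [← hp2]
  · intro j _ hj
    simp [hj]
  · simp

theorem plucker_same {n : ℕ} (g : Matrix (Fin n) (Fin n) ℝ) (I T : Finset (Fin n))
    (hI : I.card = T.card + 2) (a b c d : Fin n) (ha : a ∉ T) (hb : b ∉ T) (hc : c ∉ T)
    (hd : d ∉ T) (hab : a < b) (hbc : b < c) (hcd : c < d) :
    minor g I (insert a (insert c T)) * minor g I (insert b (insert d T)) =
      minor g I (insert a (insert b T)) * minor g I (insert c (insert d T)) +
      minor g I (insert a (insert d T)) * minor g I (insert b (insert c T)) := by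
  rw [minor_two g I T rfl hI a c ha hc (hab.trans hbc),
    minor_two g I T rfl hI b d hb hd (hbc.trans hcd),
    minor_two g I T rfl hI a b ha hb hab, minor_two g I T rfl hI c d hc hd hcd,
    minor_two g I T rfl hI a d ha hd (hab.trans (hbc.trans hcd)),
    minor_two g I T rfl hI b c hb hc hbc]
  have := plucker_vec (fun q i => g (I.orderEmbOfFin hI i) (T.orderEmbOfFin rfl q))
    (fun i => g (I.orderEmbOfFin hI i) a) (fun i => g (I.orderEmbOfFin hI i) b)
    (fun i => g (I.orderEmbOfFin hI i) c) (fun i => g (I.orderEmbOfFin hI i) d)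
    (FF g (I.orderEmbOfFin hI) (T.orderEmbOfFin rfl)) (fun x y => rfl)
  linear_combination (-(-1) ^ (T.filter fun s => s < a).card * (-1) ^ (T.filter fun s => s < b).card *
    (-1) ^ (T.filter fun s => s < c).card * (-1) ^ (T.filter fun s => s < d).card) * this

theorem plucker_two {n : ℕ} (g : Matrix (Fin n) (Fin n) ℝ) (I T : Finset (Fin n)) (ρ : Fin n)
    (hI : I.card = T.card + 1) (hρ : ∀ i ∈ I, i < ρ)
    (a b c : Fin n) (ha : a ∉ T) (hb : b ∉ T) (hc : c ∉ T)
    (hab : a < b) (hbc : b < c) :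
    minor g I (insert b T) * minor g (insert ρ I) (insert a (insert c T)) =
      minor g I (insert a T) * minor g (insert ρ I) (insert b (insert c T)) +
      minor g I (insert c T) * minor g (insert ρ I) (insert a (insert b T)) := by
  have hI' : (insert ρ I).card = T.card + 2 := by
    rw [card_insert_of_notMem (fun h => lt_irrefl _ (hρ _ h)), hI]
  rw [minor_two g (insert ρ I) T rfl hI' a c ha hc (hab.trans hbc),
    minor_two g (insert ρ I) T rfl hI' b c hb hc hbc,
    minor_two g (insert ρ I) T rfl hI' a b ha hb hab,
    minor_one g I T ρ rfl hI hρ hI' a ha, minor_one g I T ρ rfl hI hρ hI' b hb,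
    minor_one g I T ρ rfl hI hρ hI' c hc]
  have := plucker_vec (fun q i => g ((insert ρ I).orderEmbOfFin hI' i) (T.orderEmbOfFin rfl q))
    (fun i => if i = Fin.last _ then 1 else 0)
    (fun i => g ((insert ρ I).orderEmbOfFin hI' i) a)
    (fun i => g ((insert ρ I).orderEmbOfFin hI' i) b)
    (fun i => g ((insert ρ I).orderEmbOfFin hI' i) c)
    (FF g ((insert ρ I).orderEmbOfFin hI') (T.orderEmbOfFin rfl)) (fun x y => rfl)
  linear_combination (-(-1) ^ (T.filter fun s => s < a).card * (-1) ^ (T.filter fun s => s < b).card *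
    (-1) ^ (T.filter fun s => s < c).card * (-1) ^ (T.card + 1)) * this

/-- number of elements that are at least `z` -/
def cnt {n : ℕ} (z : ℕ) (J : Finset (Fin n)) : ℕ := (J.filter fun j : Fin n => z ≤ (j : ℕ)).card

/-- Gale order -/
def Gale {n : ℕ} (L J : Finset (Fin n)) : Prop := ∀ z, cnt z L ≤ cnt z J

theorem cnt_insert {n : ℕ} (z : ℕ) (J : Finset (Fin n)) (a : Fin n) (h : a ∉ J) :
    cnt z (insert a J) = cnt z J + if z ≤ (a : ℕ) then 1 else 0 := by
  unfold cnt
  rw [filter_insert]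
  split_ifs
  · rw [card_insert_of_notMem]
    simp [h]
  · rfl

theorem cnt_zero {n : ℕ} (J : Finset (Fin n)) : cnt 0 J = J.card := by
  simp [cnt]

theorem cnt_full {n : ℕ} (z : ℕ) (J : Finset (Fin n)) (h : ∀ j ∈ J, z ≤ (j : ℕ)) :
    cnt z J = J.card := by
  unfold cnt; rw [filter_true_of_mem h]

theorem cnt_none {n : ℕ} (z : ℕ) (J : Finset (Fin n)) (h : ∀ j ∈ J, (j : ℕ) < z) :
    cnt z J = 0 := by
  unfold cnt; rw [filter_false_of_mem (fun j hj => not_le.2 (h j hj)), card_empty]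

theorem cnt_le {n : ℕ} (z : ℕ) (J : Finset (Fin n)) : cnt z J ≤ J.card := card_filter_le _ _

theorem cnt_pos {n : ℕ} (z : ℕ) (J : Finset (Fin n)) (a : Fin n) (ha : a ∈ J)
    (hz : z ≤ (a : ℕ)) : 0 < cnt z J := by
  unfold cnt; apply card_pos.2; exact ⟨a, by simp [ha, hz]⟩

theorem cnt_anti {n : ℕ} {z z' : ℕ} (h : z ≤ z') (J : Finset (Fin n)) : cnt z' J ≤ cnt z J := by
  unfold cnt; apply card_le_card
  intro x; simp only [mem_filter]; rintro ⟨h1, h2⟩; exact ⟨h1, h.trans h2⟩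

theorem cnt_stable {n : ℕ} {z z' : ℕ} (h : z ≤ z') (J : Finset (Fin n))
    (hJ : ∀ j ∈ J, z ≤ (j : ℕ) → z' ≤ (j : ℕ)) : cnt z J = cnt z' J := by
  unfold cnt; congr 1
  ext x; simp only [mem_filter]
  exact ⟨fun ⟨h1, h2⟩ => ⟨h1, hJ _ h1 h2⟩, fun ⟨h1, h2⟩ => ⟨h1, h.trans h2⟩⟩

theorem cnt_succ {n : ℕ} (a : Fin n) (J : Finset (Fin n)) :
    cnt (a : ℕ) J = cnt ((a : ℕ) + 1) J + if a ∈ J then 1 else 0 := by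
  split_ifs with h
  · obtain ⟨K, hK, rfl⟩ : ∃ K, a ∉ K ∧ J = insert a K :=
      ⟨J.erase a, by simp, (insert_erase h).symm⟩
    rw [cnt_insert _ _ _ hK, cnt_insert _ _ _ hK]
    rw [if_pos le_rfl, if_neg (by omega)]
    rw [add_zero, cnt_stable (z := (a : ℕ)) (z' := (a : ℕ) + 1) (by omega)]
    intro j hj hle
    have : j ≠ a := fun e => hK (e ▸ hj)
    have : (j : ℕ) ≠ a := fun e => this (Fin.ext e)
    omega
  · rw [add_zero]
    apply cnt_stable (by omega)
    intro j hj hle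
    have : j ≠ a := fun e => h (e ▸ hj)
    have : (j : ℕ) ≠ a := fun e => this (Fin.ext e)
    omega

theorem Gale.insert {n : ℕ} {I K : Finset (Fin n)} (h : Gale I K) (a : Fin n) (hI : a ∉ I)
    (hK : a ∉ K) : Gale (insert a I) (insert a K) := by
  intro z
  rw [cnt_insert _ _ _ hI, cnt_insert _ _ _ hK]
  have := h z
  omega

theorem Gale.of_insert {n : ℕ} {I K : Finset (Fin n)} (a : Fin n) (hI : a ∉ I)
    (hK : a ∉ K) (h : Gale (Insert.insert a I) (Insert.insert a K)) : Gale I K := by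
  intro z
  have := h z
  rw [cnt_insert _ _ _ hI, cnt_insert _ _ _ hK] at this
  omega

def Supp {n : ℕ} (v : Equiv.Perm (Fin n)) (g : Matrix (Fin n) (Fin n) ℝ) : Prop :=
  ∀ i j, g i j ≠ 0 → i ≤ v j ∧ v.symm i ≤ j

def vm {n : ℕ} (v : Equiv.Perm (Fin n)) (L : Finset (Fin n)) : Finset (Fin n) :=
  L.map v.toEmbedding

theorem mem_vm {n : ℕ} {v : Equiv.Perm (Fin n)} {L : Finset (Fin n)} {i : Fin n} :
    i ∈ vm v L ↔ v.symm i ∈ L := by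
  unfold vm; rw [mem_map_equiv]

theorem card_vm {n : ℕ} (v : Equiv.Perm (Fin n)) (L : Finset (Fin n)) :
    (vm v L).card = L.card := card_map _

theorem vm_insert {n : ℕ} (v : Equiv.Perm (Fin n)) (L : Finset (Fin n)) (a : Fin n) :
    vm v (insert a L) = insert (v a) (vm v L) := by
  unfold vm; rw [map_insert]; rfl

theorem card_filter_emb {n k : ℕ} (J : Finset (Fin n)) (h : J.card = k) (P : Fin n → Prop) [DecidablePred P] :
    (J.filter P).card = (univ.filter fun q => P (J.orderEmbOfFin h q)).card := by
  conv_lhs => rw [← map_orderEmbOfFin_univ J h]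
  rw [filter_map, card_map]; rfl

theorem minor_zero {n : ℕ} {v : Equiv.Perm (Fin n)} {g : Matrix (Fin n) (Fin n) ℝ}
    (hS : Supp v g) (L J : Finset (Fin n)) (hc : J.card = L.card) (hng : ¬ Gale L J) :
    minor g (vm v L) J = 0 := by
  rw [minor_eq g _ _ (card_vm v L) hc, det_apply']
  refine Finset.sum_eq_zero fun σ _ => ?_
  suffices h : ∃ i, (g.submatrix ((vm v L).orderEmbOfFin (card_vm v L)) (J.orderEmbOfFin hc))
      (σ i) i = 0 by
    obtain ⟨i, hi⟩ := h
    exact mul_eq_zero_of_right _ (Finset.prod_eq_zero (mem_univ i) hi)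
  by_contra hne
  push Not at hne
  apply hng
  intro z
  have h1 : cnt z L = ((vm v L).filter fun i : Fin n => z ≤ (v.symm i : ℕ)).card := by
    unfold cnt vm
    rw [filter_map, card_map]
    congr 1
    ext x; simp
  rw [h1, cnt, card_filter_emb _ (card_vm v L), card_filter_emb _ hc]
  refine Finset.card_le_card_of_injOn (fun q => σ.symm q) ?_ (σ.symm.injective.injOn)
  intro q hq
  simp only [coe_filter, mem_univ, true_and, Set.mem_setOf_eq] at hq ⊢
  have h2 := (hS _ _ (hne (σ.symm q))).2
  rw [Equiv.apply_symm_apply] at h2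
  exact hq.trans h2

/-- relatively lower row sets, indexed by their pivot columns -/
def Ok {n : ℕ} (v : Equiv.Perm (Fin n)) (B L : Finset (Fin n)) : Prop :=
  L ⊆ B ∧ ∀ x ∈ L, ∀ y ∈ B, v y ≤ v x → y ∈ L

def RP {n : ℕ} (v : Equiv.Perm (Fin n)) (B : Finset (Fin n)) (g : Matrix (Fin n) (Fin n) ℝ) :
    Prop :=
  ∀ U ⊆ B, (∀ x ∈ U, ∀ y ∈ B, x ≤ y → y ∈ U) → ∀ I ⊆ vm v B, I.card = U.card →
    Gale I (vm v U) → 0 < minor g I U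

def TP {n : ℕ} (v : Equiv.Perm (Fin n)) (B : Finset (Fin n)) (g : Matrix (Fin n) (Fin n) ℝ) :
    Prop :=
  ∀ L, Ok v B L → ∀ J ⊆ B, J.card = L.card → Gale L J → 0 < minor g (vm v L) J

theorem pos_of_rel {A B C D E F : ℝ} (h : A * B = C * D + E * F) (hA : 0 < A) (hC : 0 ≤ C)
    (hD : 0 ≤ D) (hE : 0 < E) (hF : 0 < F) : 0 < B := by
  have h1 : 0 < A * B := by rw [h]; positivity
  exact (mul_pos_iff_of_pos_left hA).1 h1

/-- initial rows are Gale-minimal -/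
theorem gale_lower {n : ℕ} (v : Equiv.Perm (Fin n)) (B L J : Finset (Fin n)) (hL : Ok v B L)
    (hJ : J ⊆ B) (hc : J.card = L.card) : Gale (vm v L) (vm v J) := by
  intro z
  by_cases h : ∃ x ∈ L, z ≤ (v x : ℕ)
  · obtain ⟨x, hx, hxz⟩ := h
    have key : ((vm v J).filter fun j : Fin n => ¬ z ≤ (j : ℕ)) ⊆ ((vm v L).filter fun j : Fin n => ¬ z ≤ (j : ℕ)) := by
      intro y
      simp only [mem_filter, mem_vm]
      rintro ⟨h1, h2⟩
      refine ⟨hL.2 x hx _ (hJ h1) ?_, h2⟩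
      rw [Equiv.apply_symm_apply, Fin.le_def]; omega
    have h1 := card_le_card key
    have h2 := card_filter_add_card_filter_not (s := vm v J) (fun j : Fin n => z ≤ (j : ℕ))
    have h3 := card_filter_add_card_filter_not (s := vm v L) (fun j : Fin n => z ≤ (j : ℕ))
    rw [card_vm] at h2 h3
    unfold cnt
    omega
  · push Not at h
    rw [cnt_none]
    · omega
    · intro j hj
      rw [mem_vm] at hj
      have := h _ hj
      simpa using this

theorem card_ins2 {n : ℕ} {T : Finset (Fin n)} {a b : Fin n} (ha : a ∉ T) (hb : b ∉ T)
    (hab : a ≠ b) : (insert a (insert b T)).card = T.card + 2 := by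
  rw [card_insert_of_notMem (by simp [ha, hab]), card_insert_of_notMem hb]

theorem cnt_ins2 {n : ℕ} {T : Finset (Fin n)} {a b : Fin n} (ha : a ∉ T) (hb : b ∉ T)
    (hab : a ≠ b) (z : ℕ) : cnt z (insert a (insert b T)) =
      cnt z T + (if z ≤ (b : ℕ) then 1 else 0) + if z ≤ (a : ℕ) then 1 else 0 := by
  rw [cnt_insert _ _ _ (by simp [ha, hab]), cnt_insert _ _ _ hb]

theorem ex_pair {n : ℕ} {J : Finset (Fin n)} {a b : Fin n} (ha : a ∈ J) (hb : b ∈ J)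
    (hab : a ≠ b) : ∃ T, T ⊆ J ∧ a ∉ T ∧ b ∉ T ∧ J = insert a (insert b T) := by
  refine ⟨(J.erase a).erase b, ?_, by simp, by simp, ?_⟩
  · exact (erase_subset _ _).trans (erase_subset _ _)
  · rw [insert_erase (mem_erase.2 ⟨hab.symm, hb⟩), insert_erase ha]

theorem stepC {n : ℕ} (v : Equiv.Perm (Fin n)) (B : Finset (Fin n))
    (g : Matrix (Fin n) (Fin n) ℝ) (hS : Supp v g) (hRP : RP v B g) (c d : Fin n)
    (hcB : c ∈ B) (hdB : d ∈ B) (hdmax : ∀ x ∈ B, x ≤ d) (hcmin : ∀ x ∈ B, v c ≤ v x)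
    (hA : ∀ L, Ok v B L → ∀ J ⊆ B, J.card = L.card → Gale L J → (d ∉ J ∨ d ∈ L) →
      0 < minor g (vm v L) J)
    (hB : ∀ L, Ok v B L → ∀ J ⊆ B, J.card = L.card → Gale L J → c ∈ J →
      0 < minor g (vm v L) J) : TP v B g := by
  have nn : ∀ L, Ok v B L → ∀ J ⊆ B, J.card = L.card → (d ∉ J ∨ c ∈ J) →
      0 ≤ minor g (vm v L) J := by
    intro L hL J hJ hcard h
    by_cases hG : Gale L J
    · rcases h with h | h
      · exact (hA L hL J hJ hcard hG (Or.inl h)).le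
      · exact (hB L hL J hJ hcard hG h).le
    · rw [minor_zero hS L J hcard hG]
  intro L
  induction hN : L.card using Nat.strong_induction_on generalizing L with
  | _ N ihN =>
  intro hL J
  induction hM : ∑ j ∈ J, (n - (j : ℕ)) using Nat.strong_induction_on generalizing J with
  | _ M ihM =>
  intro hJ hcard hG
  rw [← hN] at hcard
  by_cases h1 : d ∉ J ∨ d ∈ L
  · exact hA L hL J hJ hcard hG h1
  by_cases h2 : c ∈ J
  · exact hB L hL J hJ hcard hG h2
  push Not at h1
  obtain ⟨hdJ, hdL⟩ := h1
  have hcL : c ∈ L := by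
    have : 0 < L.card := by rw [← hcard]; exact card_pos.2 ⟨d, hdJ⟩
    obtain ⟨x, hx⟩ := card_pos.1 this
    exact hL.2 x hx c hcB (hcmin x (hL.1 hx))
  have case2 : ∀ t x, t ∈ J → x ∈ B → x ∉ J → c < t → t < x → x < d →
      (∀ z : ℕ, (c : ℕ) < z → z ≤ (t : ℕ) → cnt z L < cnt z J) →
      (∀ z : ℕ, (x : ℕ) < z → z ≤ (d : ℕ) → cnt z L < cnt z J) →
      0 < minor g (vm v L) J := by
    intro t x ht hx hxJ hct htx hxd hf1 hf2
    obtain ⟨T, hTJ, htT, hdT, hJe⟩ := ex_pair ht hdJ (htx.trans hxd).ne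
    have hxT : x ∉ T := fun h => hxJ (hTJ h)
    have hcT : c ∉ T := fun h => h2 (hTJ h)
    have hTB := hTJ.trans hJ
    have htB := hJ ht
    have hTc : T.card + 2 = J.card := by rw [hJe, card_ins2 htT hdT (htx.trans hxd).ne]
    have cJ := cnt_ins2 htT hdT (htx.trans hxd).ne
    rw [← hJe] at cJ
    have rel := plucker_same g (vm v L) T (by rw [card_vm]; omega) c t x d hcT htT hxT hdT
      hct htx hxd
    rw [← hJe] at rel
    have hct' : (c : ℕ) < t := hct
    have htx' : (t : ℕ) < x := htx
    have hxd' : (x : ℕ) < d := hxd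
    refine pos_of_rel rel ?_ ?_ ?_ ?_ ?_
    · apply hB L hL
      · simp only [insert_subset_iff]; exact ⟨hcB, hx, hTB⟩
      · rw [card_ins2 hcT hxT (hct.trans htx).ne]; omega
      · intro z
        rw [cnt_ins2 hcT hxT (hct.trans htx).ne]
        have a1 := cJ z
        have a2 := hG z
        have a3 := hf1 z
        have a4 := hf2 z
        split_ifs at * <;> omega
      · simp
    · apply nn L hL
      · simp only [insert_subset_iff]; exact ⟨hcB, htB, hTB⟩
      · rw [card_ins2 hcT htT hct.ne]; omega
      · right; simp
    · refine (ihM _ ?_ (insert x (insert d T)) rfl ?_ ?_ ?_).le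
      · rw [← hM, hJe, sum_insert (by simp [hxT, hxd.ne]), sum_insert hdT,
          sum_insert (by simp [htT, (htx.trans hxd).ne]), sum_insert hdT]
        have := x.isLt
        omega
      · simp only [insert_subset_iff]; exact ⟨hx, hdB, hTB⟩
      · rw [card_ins2 hxT hdT hxd.ne]; omega
      · intro z
        rw [cnt_ins2 hxT hdT hxd.ne]
        have a1 := cJ z
        have a2 := hG z
        split_ifs at * <;> omega
    · apply hB L hL
      · simp only [insert_subset_iff]; exact ⟨hcB, hdB, hTB⟩
      · rw [card_ins2 hcT hdT (hct.trans (htx.trans hxd)).ne]; omega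
      · intro z
        rw [cnt_ins2 hcT hdT (hct.trans (htx.trans hxd)).ne]
        have a1 := cJ z
        have a2 := hG z
        have a3 := hf1 z
        split_ifs at * <;> omega
      · simp
    · apply hA L hL
      · simp only [insert_subset_iff]; exact ⟨htB, hx, hTB⟩
      · rw [card_ins2 htT hxT htx.ne]; omega
      · intro z
        rw [cnt_ins2 htT hxT htx.ne]
        have a1 := cJ z
        have a2 := hG z
        have a4 := hf2 z
        split_ifs at * <;> omega
      · left
        simp [hdT, hxd.ne', (htx.trans hxd).ne']
  have hcd : c < d := lt_of_le_of_ne (hdmax c hcB) (fun h => h2 (h ▸ hdJ))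
  have hcd' : (c : ℕ) < d := hcd
  have fc : cnt ((c : ℕ) + 1) L < cnt ((c : ℕ) + 1) J := by
    have a1 := cnt_succ c J
    have a2 := cnt_succ c L
    rw [if_neg h2] at a1
    rw [if_pos hcL] at a2
    have := hG c
    omega
  by_cases hz : ∃ z, (c : ℕ) < z ∧ z ≤ (d : ℕ) ∧ cnt z J ≤ cnt z L
  · obtain ⟨z, ⟨hz1, hz2, hz3⟩, hzmax⟩ : ∃ z, ((c : ℕ) < z ∧ z ≤ (d : ℕ) ∧ cnt z J ≤ cnt z L) ∧
        ∀ z', ((c : ℕ) < z' ∧ z' ≤ (d : ℕ) ∧ cnt z' J ≤ cnt z' L) → z' ≤ z := by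
      obtain ⟨z0, hz0⟩ := hz
      refine ⟨_, Nat.findGreatest_spec (P := fun z => (c : ℕ) < z ∧ z ≤ (d : ℕ) ∧
        cnt z J ≤ cnt z L) (n := (d : ℕ)) hz0.2.1 hz0, ?_⟩
      intro z' hz'
      exact Nat.le_findGreatest hz'.2.1 hz'
    have hzd : z ≠ d := by
      intro e
      have a1 := cnt_succ d J
      have a2 := cnt_succ d L
      rw [if_pos hdJ] at a1
      rw [if_neg hdL] at a2
      have a3 := hG (d + 1)
      rw [e] at hz3
      omega
    have hf2 : ∀ z' : ℕ, z < z' → z' ≤ (d : ℕ) → cnt z' L < cnt z' J := by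
      intro z' h1 h3
      by_contra h4
      have := hzmax z' ⟨by omega, h3, by omega⟩
      omega
    have hx' : z < n := lt_of_le_of_lt hz2 d.isLt
    set x : Fin n := ⟨z, hx'⟩ with hx
    have a1 := cnt_succ x J
    have a2 := cnt_succ x L
    have a3 := hf2 (z + 1) (by omega) (by omega)
    have hxv : (x : ℕ) = z := rfl
    rw [hxv] at a1 a2
    have hxJ : x ∉ J := by
      intro h
      rw [if_pos h] at a1
      split_ifs at a2 <;> omega
    have hxL : x ∈ L := by
      by_contra h
      rw [if_neg h] at a2
      split_ifs at a1; omega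
    obtain ⟨t, ht, htmin⟩ := Finset.exists_min_image (J.filter fun j => c < j) id
      ⟨d, by simp [hdJ, hcd]⟩
    simp only [mem_filter, id] at ht htmin
    have hf1 : ∀ z' : ℕ, (c : ℕ) < z' → z' ≤ (t : ℕ) → cnt z' L < cnt z' J := by
      intro z' h1 h3
      have b1 : cnt ((c : ℕ) + 1) J = cnt z' J := by
        apply cnt_stable (by omega)
        intro j hj hle
        have : (t : ℕ) ≤ j := htmin j ⟨hj, by rw [Fin.lt_def]; omega⟩
        omega
      have b2 : cnt z' L ≤ cnt ((c : ℕ) + 1) L := cnt_anti (by omega) L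
      omega
    have htx : t < x := by
      by_contra h
      have h' : z ≤ (t : ℕ) := not_lt.1 h
      have := hf1 z hz1 h'
      omega
    refine case2 t x ht.1 (hL.1 hxL) hxJ ht.2 htx ?_ hf1 hf2
    rw [Fin.lt_def]; omega
  push Not at hz
  by_cases hb : ∃ b ∈ J, b < c
  · obtain ⟨b, hbJ, hbmin⟩ := Finset.exists_min_image J id ⟨d, hdJ⟩
    simp only [id] at hbmin
    have hbc : b < c := by
      obtain ⟨b', h, h'⟩ := hb
      exact (hbmin b' h).trans_lt h'
    have hbc' : (b : ℕ) < c := hbc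
    obtain ⟨T, hTJ, hbT, hdT, hJe⟩ := ex_pair hbJ hdJ (hbc.trans hcd).ne
    have hcT : c ∉ T := fun h => h2 (hTJ h)
    have hTB := hTJ.trans hJ
    have hbB := hJ hbJ
    have hTc : T.card + 2 = J.card := by rw [hJe, card_ins2 hbT hdT (hbc.trans hcd).ne]
    have cJ := cnt_ins2 hbT hdT (hbc.trans hcd).ne
    rw [← hJe] at cJ
    obtain ⟨y, hyL, hymax⟩ := Finset.exists_max_image L v ⟨c, hcL⟩
    have hyd : y < d := lt_of_le_of_ne (hdmax y (hL.1 hyL)) (fun h => hdL (h ▸ hyL))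
    have hyd' : (y : ℕ) < d := hyd
    obtain ⟨L', hyL', hLe⟩ : ∃ L', y ∉ L' ∧ L = insert y L' :=
      ⟨L.erase y, by simp, (insert_erase hyL).symm⟩
    have hLc : L.card = L'.card + 1 := by rw [hLe, card_insert_of_notMem hyL']
    have hL'L : ∀ x ∈ L', x ∈ L := fun x hx => by rw [hLe]; simp [hx]
    have hOk' : Ok v B L' := by
      refine ⟨fun x hx => hL.1 (hL'L x hx), ?_⟩
      intro x hx w hw hle
      have h3 := hL.2 x (hL'L x hx) w hw hle
      rw [hLe, mem_insert] at h3
      rcases h3 with h3 | h3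
      · subst h3
        have h4 := le_antisymm hle (hymax x (hL'L x hx))
        have h5 := v.injective h4
        subst h5
        exact hx
      · exact h3
    have cL : ∀ z, cnt z L = cnt z L' + if z ≤ (y : ℕ) then 1 else 0 := by
      intro z
      conv_lhs => rw [hLe]
      exact cnt_insert _ _ _ hyL'
    have hyb : ∀ z : ℕ, z ≤ (b : ℕ) → (y : ℕ) < z → cnt z L < cnt z J := by
      intro z h3 h4
      rw [cnt_full z J (fun j hj => h3.trans (hbmin j hj)), cL z, if_neg (by omega)]
      have := cnt_le z L'
      omega
    have hvm : vm v L = insert (v y) (vm v L') := by rw [← vm_insert, ← hLe]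
    have rel := plucker_two g (vm v L') T (v y) (by rw [card_vm]; omega) ?_ b c d hbT hcT hdT
      hbc hcd
    · rw [← hJe, ← hvm] at rel
      refine pos_of_rel rel ?_ ?_ ?_ ?_ ?_
      · apply hB L' hOk'
        · simp only [insert_subset_iff]; exact ⟨hcB, hTB⟩
        · rw [card_insert_of_notMem hcT]; omega
        · intro z
          rw [cnt_insert _ _ _ hcT]
          have a1 := cJ z
          have a2 := hG z
          have a3 := hz z
          have a4 := hyb z
          have a5 := cL z
          split_ifs at * <;> omega
        · simp
      · apply nn L' hOk'
        · simp only [insert_subset_iff]; exact ⟨hbB, hTB⟩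
        · rw [card_insert_of_notMem hbT]; omega
        · left; simp [hdT, (hbc.trans hcd).ne']
      · apply nn L hL
        · simp only [insert_subset_iff]; exact ⟨hcB, hdB, hTB⟩
        · rw [card_ins2 hcT hdT hcd.ne]; omega
        · right; simp
      · apply ihN L'.card (by omega) L' rfl hOk'
        · simp only [insert_subset_iff]; exact ⟨hdB, hTB⟩
        · rw [card_insert_of_notMem hdT]; omega
        · intro z
          rw [cnt_insert _ _ _ hdT]
          have a1 := cJ z
          have a2 := hG z
          have a4 := hyb z
          have a5 := cL z
          split_ifs at * <;> omega
      · apply hA L hL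
        · simp only [insert_subset_iff]; exact ⟨hbB, hcB, hTB⟩
        · rw [card_ins2 hbT hcT hbc.ne]; omega
        · intro z
          rw [cnt_ins2 hbT hcT hbc.ne]
          have a1 := cJ z
          have a2 := hG z
          have a3 := hz z
          split_ifs at * <;> omega
        · left; simp [hdT, (hbc.trans hcd).ne', hcd.ne']
    · intro i hi
      rw [mem_vm] at hi
      have h3 := hymax _ (hL'L _ hi)
      rw [Equiv.apply_symm_apply] at h3
      refine lt_of_le_of_ne h3 ?_
      rintro rfl
      rw [Equiv.symm_apply_apply] at hi
      exact hyL' hi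
  · push Not at hb
    by_cases hup : ∀ x ∈ J, ∀ y ∈ B, x ≤ y → y ∈ J
    · refine hRP J hJ hup (vm v L) ?_ ?_ ?_
      · intro i hi
        rw [mem_vm] at hi ⊢
        exact hL.1 hi
      · rw [card_vm]; omega
      · exact gale_lower v B L J hL hJ hcard
    · push Not at hup
      obtain ⟨t, ht, y, hy, hty, hyJ⟩ := hup
      have h3 : c < t := lt_of_le_of_ne (hb t ht) (fun h => h2 (h ▸ ht))
      have h4 : t < y := lt_of_le_of_ne hty (fun h => hyJ (h ▸ ht))
      have h5 : y < d := lt_of_le_of_ne (hdmax y hy) (fun h => hyJ (h ▸ hdJ))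
      have h4' : (t : ℕ) < y := h4
      have h5' : (y : ℕ) < d := h5
      have h3' : (c : ℕ) < t := h3
      exact case2 t y ht hy hyJ h3 h4 h5 (fun z a b => hz z a (by omega))
        (fun z a b => hz z (by omega) b)

def gA {n : ℕ} (g : Matrix (Fin n) (Fin n) ℝ) (r : Fin n) : Matrix (Fin n) (Fin n) ℝ :=
  of fun i j => (fun i => if r < i then (-1 : ℝ) else 1) i * g i j * (fun _ => (1 : ℝ)) j

def gB {n : ℕ} (g : Matrix (Fin n) (Fin n) ℝ) (c : Fin n) : Matrix (Fin n) (Fin n) ℝ :=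
  of fun i j => (fun _ => (1 : ℝ)) i * g i j * (fun j => if j < c then (-1 : ℝ) else 1) j

theorem prod_sign {n : ℕ} (I : Finset (Fin n)) (P : Fin n → Prop) [DecidablePred P] :
    (∏ i ∈ I, if P i then (-1 : ℝ) else 1) = (-1) ^ (I.filter P).card := by
  rw [Finset.prod_ite]; simp

theorem minor_gA {n : ℕ} (g : Matrix (Fin n) (Fin n) ℝ) (r : Fin n) (I J : Finset (Fin n))
    (h : I.card = J.card) :
    minor (gA g r) I J = (-1) ^ (I.filter fun i => r < i).card * minor g I J := by
  unfold gA
  rw [minor_scale g _ _ I J h, prod_sign]; simp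

theorem minor_gB {n : ℕ} (g : Matrix (Fin n) (Fin n) ℝ) (c : Fin n) (I J : Finset (Fin n))
    (h : I.card = J.card) :
    minor (gB g c) I J = (-1) ^ (J.filter fun i => i < c).card * minor g I J := by
  unfold gB
  rw [minor_scale g _ _ I J h, prod_sign]; simp [mul_comm]

theorem Supp.gA {n : ℕ} {v : Equiv.Perm (Fin n)} {g : Matrix (Fin n) (Fin n) ℝ}
    (hS : Supp v g) (r : Fin n) : Supp v (gA g r) := by
  intro i j h
  apply hS
  intro h0
  apply h
  simp [Paper.gA, h0]

theorem Supp.gB {n : ℕ} {v : Equiv.Perm (Fin n)} {g : Matrix (Fin n) (Fin n) ℝ}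
    (hS : Supp v g) (r : Fin n) : Supp v (gB g r) := by
  intro i j h
  apply hS
  intro h0
  apply h
  simp [Paper.gB, h0]

theorem lemA {n : ℕ} {v : Equiv.Perm (Fin n)} {g : Matrix (Fin n) (Fin n) ℝ}
    (hS : Supp v g) (d : Fin n) (I U : Finset (Fin n)) (hr : v d ∉ I) (hU : ∀ x ∈ U, x < d)
    (hc : I.card = U.card) :
    minor g (insert (v d) I) (insert d U) = g (v d) d * minor (gA g (v d)) I U := by
  have hd : d ∉ U := fun h => lt_irrefl _ (hU d h)
  rw [minor_insert_row g I U _ _ hr hd hc, minor_gA _ _ _ _ hc]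
  · have h1 : U.filter (fun x => x < d) = U := filter_true_of_mem hU
    have h2 := card_filter_add_card_filter_not (s := I) (fun j => j < v d)
    have h3 : I.filter (fun j => ¬ j < v d) = I.filter (fun j => v d < j) := by
      apply filter_congr
      intro x hx
      have : x ≠ v d := fun e => hr (e ▸ hx)
      rw [not_lt]; exact ⟨fun h => lt_of_le_of_ne h this.symm, le_of_lt⟩
    rw [h3] at h2
    rw [h1, ← hc, ← h2, ← add_assoc, pow_add, ← two_mul, pow_mul]
    norm_num
    ring
  · intro j hj
    by_contra h
    have := (hS _ _ h).2
    rw [Equiv.symm_apply_apply] at this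
    exact absurd (hU j hj) (not_lt.2 this)

theorem lemB {n : ℕ} {v : Equiv.Perm (Fin n)} {g : Matrix (Fin n) (Fin n) ℝ}
    (hS : Supp v g) (c : Fin n) (I U : Finset (Fin n)) (hI : ∀ i ∈ I, v c < i) (hU : c ∉ U)
    (hc : I.card = U.card) :
    minor g (insert (v c) I) (insert c U) = g (v c) c * minor (gB g c) I U := by
  have hd : v c ∉ I := fun h => lt_irrefl _ (hI _ h)
  rw [minor_insert_col g I U _ _ hd hU hc, minor_gB _ _ _ _ hc]
  · have h1 : I.filter (fun x => x < v c) = ∅ :=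
      filter_false_of_mem fun x hx => not_lt.2 (hI x hx).le
    rw [h1, card_empty, zero_add]
    ring
  · intro i hi
    by_contra h
    have := (hS _ _ h).1
    exact absurd (hI i hi) (not_lt.2 this)

theorem vm_erase_mem {n : ℕ} {v : Equiv.Perm (Fin n)} {B I : Finset (Fin n)} {d : Fin n}
    (hI : I ⊆ vm v (B.erase d)) : v d ∉ I := by
  intro h
  have := hI h
  rw [mem_vm] at this
  simp at this

theorem RP_imp_TP {n : ℕ} (v : Equiv.Perm (Fin n)) : ∀ (k : ℕ) (B : Finset (Fin n)), B.card = k →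
    ∀ g, Supp v g → RP v B g → TP v B g := by
  intro k
  induction k with
  | zero =>
    intro B hB g hS hR L hL J hJ hc hG
    rw [card_eq_zero] at hB
    subst hB
    have h1 : L = ∅ := subset_empty.1 hL.1
    have h2 : J = ∅ := subset_empty.1 hJ
    subst h1 h2
    have : vm v (∅ : Finset (Fin n)) = ∅ := rfl
    rw [this, minor_empty]; norm_num
  | succ k ih =>
    intro B hB g hS hR
    have hne : B.Nonempty := card_pos.1 (by omega)
    obtain ⟨d, hdB, hdmax⟩ := B.exists_max_image id hne
    obtain ⟨c, hcB, hcmin⟩ := B.exists_min_image v hne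
    simp only [id] at hdmax
    have hvm : ∀ U, U ⊆ B → vm v U ⊆ vm v B := fun U hU => by
      intro x hx; rw [mem_vm] at hx ⊢; exact hU hx
    -- part A
    have grd : 0 < g (v d) d := by
      have := hR {d} (by simpa using hdB) (by
        intro x hx y hy hxy
        rw [mem_singleton] at hx ⊢
        subst hx
        exact le_antisymm (hdmax y hy) hxy) (vm v {d}) (hvm _ (by simpa using hdB)) (card_vm _ _)
        (fun z => le_rfl)
      have e := lemA hS d ∅ ∅ (by simp) (by simp) rfl
      rw [minor_empty, mul_one] at e
      have e2 : vm v {d} = insert (v d) ∅ := by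
        have := vm_insert v ∅ d
        exact this
      rw [e2] at this
      rw [← e]; exact this
    have RA : RP v (B.erase d) (gA g (v d)) := by
      intro U hU hup I hI hc hG
      have hr := vm_erase_mem hI
      have hdU : d ∉ U := fun h => by simpa using hU h
      have hUd : ∀ x ∈ U, x < d := fun x hx =>
        lt_of_le_of_ne (hdmax x (mem_of_mem_erase (hU hx))) (fun e => hdU (e ▸ hx))
      have e := lemA hS d I U hr hUd hc
      have p := hR (insert d U)
        (insert_subset hdB (hU.trans (erase_subset _ _))) (by
          intro x hx y hy hxy
          rw [mem_insert] at hx ⊢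
          by_cases hyd : y = d
          · exact Or.inl hyd
          · right
            rcases hx with rfl | hx
            · exact absurd (le_antisymm (hdmax y hy) hxy) hyd
            · exact hup x hx y (mem_erase.2 ⟨hyd, hy⟩) hxy)
        (insert (v d) I) (insert_subset (by rw [mem_vm]; simpa using hdB)
          (hI.trans (hvm _ (erase_subset _ _))))
        (by rw [card_insert_of_notMem hr, card_insert_of_notMem hdU, hc])
        (by
          rw [vm_insert]
          exact hG.insert _ hr (by rw [mem_vm]; simpa using hdU))
      rw [e] at p
      exact (mul_pos_iff_of_pos_left grd).1 p
    have TA := ih (B.erase d) (by rw [card_erase_of_mem hdB]; omega) _ (hS.gA (v d)) RA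
    have hA : ∀ L, Ok v B L → ∀ J ⊆ B, J.card = L.card → Gale L J → (d ∉ J ∨ d ∈ L) →
      0 < minor g (vm v L) J := by
      intro L hL J hJ hcard hG hor
      have hLJ : d ∈ L → d ∈ J := by
        intro h
        have h1 := (cnt_pos d L d h le_rfl).trans_le (hG d)
        unfold cnt at h1
        obtain ⟨j, hj⟩ := card_pos.1 h1
        rw [mem_filter] at hj
        have : j = d := le_antisymm (hdmax j (hJ hj.1)) hj.2
        exact this ▸ hj.1
      by_cases hdL : d ∈ L
      · have hdJ := hLJ hdL
        obtain ⟨L', hL', rfl⟩ : ∃ K, d ∉ K ∧ L = insert d K :=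
          ⟨L.erase d, by simp, (insert_erase hdL).symm⟩
        obtain ⟨J', hJ', rfl⟩ : ∃ K, d ∉ K ∧ J = insert d K :=
          ⟨J.erase d, by simp, (insert_erase hdJ).symm⟩
        have hcc : J'.card = L'.card := by
          rw [card_insert_of_notMem hL', card_insert_of_notMem hJ'] at hcard; omega
        have hJs : J' ⊆ B.erase d := fun x hx =>
          mem_erase.2 ⟨fun e => hJ' (e ▸ hx), hJ (mem_insert_of_mem hx)⟩
        have p := TA L' ⟨fun x hx =>
          mem_erase.2 ⟨fun e => hL' (e ▸ hx), hL.1 (mem_insert_of_mem hx)⟩, by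
            intro x hx y hy hxy
            rw [mem_erase] at hy
            have := hL.2 x (mem_insert_of_mem hx) y hy.2 hxy
            rw [mem_insert] at this
            exact this.resolve_left hy.1⟩ J' hJs hcc (hG.of_insert d hL' hJ')
        rw [vm_insert, lemA hS d _ _ (by rw [mem_vm]; simpa using hL') (fun x hx =>
          lt_of_le_of_ne (hdmax x (mem_of_mem_erase (hJs hx))) (fun e => hJ' (e ▸ hx)))
          (by rw [card_vm, hcc])]
        exact mul_pos grd p
      · have hdJ : d ∉ J := hor.resolve_right hdL
        have p := TA L ⟨fun x hx =>
          mem_erase.2 ⟨fun e => hdL (e ▸ hx), hL.1 hx⟩, fun x hx y hy hxy =>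
            hL.2 x hx y (mem_of_mem_erase hy) hxy⟩ J (fun x hx =>
          mem_erase.2 ⟨fun e => hdJ (e ▸ hx), hJ hx⟩) hcard hG
        rw [minor_gA _ _ _ _ (by rw [card_vm, hcard]), filter_false_of_mem, card_empty, pow_zero,
          one_mul] at p
        · exact p
        · intro i hi hlt
          rw [mem_vm] at hi
          exact hdL (hL.2 _ hi d hdB (by simpa using hlt.le))
    -- part B
    have gec : 0 < g (v c) c := by
      have hcU : c ∉ B.filter (fun x => c < x) := by simp
      have p1 := hR (B.filter fun x => c < x) (filter_subset _ _) (by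
        intro x hx y hy hxy
        rw [mem_filter] at hx ⊢
        exact ⟨hy, hx.2.trans_le hxy⟩) _ (hvm _ (filter_subset _ _)) (card_vm _ _)
        (fun z => le_rfl)
      have hsub : insert c (B.filter fun x => c < x) ⊆ B :=
        insert_subset hcB (filter_subset _ _)
      have p2 := hR (insert c (B.filter fun x => c < x)) hsub (by
        intro x hx y hy hxy
        rw [mem_insert, mem_filter] at hx ⊢
        rcases hx with rfl | hx
        · rcases hxy.eq_or_lt with h | h
          · exact Or.inl h.symm
          · exact Or.inr ⟨hy, h⟩
        · exact Or.inr ⟨hy, hx.2.trans_le hxy⟩) _ (hvm _ hsub) (card_vm _ _)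
        (fun z => le_rfl)
      rw [vm_insert, lemB hS c _ _ _ hcU (card_vm _ _), minor_gB _ _ _ _ (card_vm _ _),
        filter_false_of_mem, card_empty, pow_zero, one_mul] at p2
      · exact (mul_pos_iff_of_pos_right p1).1 p2
      · intro x hx
        rw [mem_filter] at hx
        exact not_lt.2 hx.2.le
      · intro i hi
        rw [mem_vm, mem_filter] at hi
        have := hcmin _ hi.1
        rw [Equiv.apply_symm_apply] at this
        refine lt_of_le_of_ne this ?_
        rintro rfl
        simp at hi
    have hgt : ∀ I, I ⊆ vm v (B.erase c) → ∀ i ∈ I, v c < i := by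
      intro I hI i hi
      have h := hI hi
      rw [mem_vm, mem_erase] at h
      have := hcmin _ h.2
      rw [Equiv.apply_symm_apply] at this
      refine lt_of_le_of_ne this ?_
      rintro rfl
      simp at h
    have RB : RP v (B.erase c) (gB g c) := by
      intro U hU hup I hI hc hG
      have hr := vm_erase_mem hI
      have hcU : c ∉ U := fun h => by simpa using hU h
      by_cases hall : ∃ x ∈ U, x < c
      · obtain ⟨x0, hx0, hx0c⟩ := hall
        have e := lemB hS c I U (hgt I hI) hcU hc
        have p := hR (insert c U)
          (insert_subset hcB (hU.trans (erase_subset _ _))) (by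
            intro x hx y hy hxy
            rw [mem_insert] at hx ⊢
            by_cases hyd : y = c
            · exact Or.inl hyd
            · right
              rcases hx with rfl | hx
              · exact hup x0 hx0 y (mem_erase.2 ⟨hyd, hy⟩) (hx0c.le.trans hxy)
              · exact hup x hx y (mem_erase.2 ⟨hyd, hy⟩) hxy)
          (insert (v c) I) (insert_subset (by rw [mem_vm]; simpa using hcB)
            (hI.trans (hvm _ (erase_subset _ _))))
          (by rw [card_insert_of_notMem hr, card_insert_of_notMem hcU, hc])
          (by
            rw [vm_insert]
            exact hG.insert _ hr (by rw [mem_vm]; simpa using hcU))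
        rw [e] at p
        exact (mul_pos_iff_of_pos_left gec).1 p
      · push Not at hall
        rw [minor_gB _ _ _ _ hc, filter_false_of_mem (fun x hx => not_lt.2 (hall x hx)),
          card_empty, pow_zero, one_mul]
        apply hR U (hU.trans (erase_subset _ _)) _ I (hI.trans (hvm _ (erase_subset _ _))) hc hG
        intro x hx y hy hxy
        refine hup x hx y (mem_erase.2 ⟨?_, hy⟩) hxy
        rintro rfl
        exact hcU (le_antisymm hxy (hall x hx) ▸ hx)
    have TB := ih (B.erase c) (by rw [card_erase_of_mem hcB]; omega) _ (hS.gB c) RB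
    refine stepC v B g hS hR c d hcB hdB hdmax hcmin hA ?_
    intro L hL J hJ hcard hG hcJ
    have hcL : c ∈ L := by
      have : 0 < L.card := by rw [← hcard]; exact card_pos.2 ⟨c, hcJ⟩
      obtain ⟨x, hx⟩ := card_pos.1 this
      exact hL.2 x hx c hcB (hcmin x (hL.1 hx))
    obtain ⟨L', hL', rfl⟩ : ∃ K, c ∉ K ∧ L = insert c K :=
      ⟨L.erase c, by simp, (insert_erase hcL).symm⟩
    obtain ⟨J', hJ', rfl⟩ : ∃ K, c ∉ K ∧ J = insert c K :=
      ⟨J.erase c, by simp, (insert_erase hcJ).symm⟩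
    have hcc : J'.card = L'.card := by
      rw [card_insert_of_notMem hL', card_insert_of_notMem hJ'] at hcard; omega
    have hJs : J' ⊆ B.erase c := fun x hx =>
      mem_erase.2 ⟨fun e => hJ' (e ▸ hx), hJ (mem_insert_of_mem hx)⟩
    have hLs : L' ⊆ B.erase c := fun x hx =>
      mem_erase.2 ⟨fun e => hL' (e ▸ hx), hL.1 (mem_insert_of_mem hx)⟩
    have p := TB L' ⟨hLs, by
        intro x hx y hy hxy
        rw [mem_erase] at hy
        have := hL.2 x (mem_insert_of_mem hx) y hy.2 hxy
        rw [mem_insert] at this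
        exact this.resolve_left hy.1⟩ J' hJs hcc (hG.of_insert c hL' hJ')
    rw [vm_insert, lemB hS c _ _ (hgt _ (fun x hx => by
      rw [mem_vm] at hx ⊢; exact hLs hx)) hJ' (by rw [card_vm, hcc])]
    exact mul_pos gec p

def Up {n : ℕ} (U : Finset (Fin n)) : Prop := ∀ x ∈ U, ∀ y, x ≤ y → y ∈ U

theorem minor_lower {n : ℕ} (M b : Matrix (Fin n) (Fin n) ℝ) (hb1 : ∀ j, b j j = 1)
    (hb : ∀ l j, b l j ≠ 0 → j ≤ l) (I U : Finset (Fin n)) (hU : Up U) (hc : I.card = U.card) :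
    minor (M * b) I U = minor M I U := by
  rw [minor_eq _ I U hc rfl, minor_eq _ I U hc rfl]
  have h : (M * b).submatrix (I.orderEmbOfFin hc) (U.orderEmbOfFin rfl) =
      M.submatrix (I.orderEmbOfFin hc) (U.orderEmbOfFin rfl) *
      b.submatrix (U.orderEmbOfFin rfl) (U.orderEmbOfFin rfl) := by
    ext p q
    simp only [submatrix_apply, mul_apply]
    have e0 : ∀ F : Fin n → ℝ, ∑ m ∈ U, F m = ∑ x, F (U.orderEmbOfFin rfl x) := by
      intro F
      conv_lhs => rw [← map_orderEmbOfFin_univ U rfl]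
      rw [sum_map]; rfl
    have e := e0 fun m => M (I.orderEmbOfFin hc p) m * b m (U.orderEmbOfFin rfl q)
    rw [← e]
    symm
    apply sum_subset (subset_univ _)
    intro m _ hm
    by_contra hne
    have h1 := hb _ _ (right_ne_zero_of_mul hne)
    exact hm (hU _ (orderEmbOfFin_mem U rfl q) m h1)
  rw [h, det_mul]
  have h2 : (b.submatrix (U.orderEmbOfFin rfl) (U.orderEmbOfFin rfl)).det = 1 := by
    rw [det_of_isLowerTriangular]
    · exact prod_eq_one fun i _ => hb1 _
    · intro p q hpq
      by_contra hne
      have := hb _ _ hne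
      rw [OrderEmbedding.le_iff_le] at this
      exact absurd hpq (not_lt.2 this)
  rw [h2, mul_one]

theorem minor_row {n : ℕ} (g : Matrix (Fin n) (Fin n) ℝ) (i i1 : Fin n) (hi : (i1 : ℕ) = i + 1)
    (ε : ℝ) (I U : Finset (Fin n)) (hc : I.card = U.card) :
    minor (updateRow g i (g i + ε • g i1)) I U = minor g I U +
      if i ∈ I ∧ i1 ∉ I then ε * minor g (insert i1 (I.erase i)) U else 0 := by
  have hii : i1 ≠ i := fun e => by rw [e] at hi; omega
  rw [minor_eq _ I U rfl hc.symm, minor_eq _ I U rfl hc.symm]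
  by_cases h : i ∈ I
  · obtain ⟨p, hp⟩ : ∃ p, I.orderEmbOfFin rfl p = i := by
      have : i ∈ Set.range (I.orderEmbOfFin rfl) := by rw [range_orderEmbOfFin]; exact h
      exact this
    have e1 : ∀ x : Fin n → ℝ, (updateRow g i x).submatrix (I.orderEmbOfFin rfl)
        (U.orderEmbOfFin hc.symm) = updateRow (g.submatrix (I.orderEmbOfFin rfl)
        (U.orderEmbOfFin hc.symm)) p (fun q => x (U.orderEmbOfFin hc.symm q)) := by
      intro x
      ext a b
      by_cases ha : a = p
      · subst ha; simp [hp]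
      · have : I.orderEmbOfFin rfl a ≠ i := by
          rw [← hp]; exact fun e => ha ((I.orderEmbOfFin rfl).injective e)
        simp [updateRow_ne ha, updateRow_ne this]
    have e2 : (fun q => (g i + ε • g i1) (U.orderEmbOfFin hc.symm q)) =
      (g.submatrix (I.orderEmbOfFin rfl) (U.orderEmbOfFin hc.symm)) p +
        ε • (fun q => g i1 (U.orderEmbOfFin hc.symm q)) := by
      ext q; simp [hp]
    rw [e1, e2, det_updateRow_add, updateRow_eq_self, det_updateRow_smul, ← e1 (g i1)]
    congr 1
    by_cases h1 : i1 ∈ I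
    · rw [if_neg (by simp [h1])]
      obtain ⟨q, hq⟩ : ∃ p, I.orderEmbOfFin rfl p = i1 := by
        have : i1 ∈ Set.range (I.orderEmbOfFin rfl) := by rw [range_orderEmbOfFin]; exact h1
        exact this
      have hpq : p ≠ q := fun e => hii (by rw [← hp, ← hq, e])
      rw [det_zero_of_row_eq hpq, mul_zero]
      ext b
      simp [hp, hq, updateRow_ne hii]
    · rw [if_pos ⟨h, h1⟩]
      have hcard : (insert i1 (I.erase i)).card = I.card := by
        rw [card_insert_of_notMem (by simp [h1]), card_erase_add_one h]
      rw [minor_eq _ _ U hcard hc.symm]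
      congr 1
      have e3 : ∀ a, (insert i1 (I.erase i)).orderEmbOfFin hcard a =
          Function.update (I.orderEmbOfFin rfl) p i1 a := by
        intro a
        have := orderEmbOfFin_unique hcard (f := Function.update (I.orderEmbOfFin rfl) p i1) (by
          intro x
          by_cases hx : x = p
          · subst hx; simp
          · rw [Function.update_of_ne hx, mem_insert, mem_erase]
            right
            exact ⟨fun e => hx ((I.orderEmbOfFin rfl).injective (e.trans hp.symm)),
              orderEmbOfFin_mem _ _ _⟩) (by
          intro x y hxy
          have hxy' := (I.orderEmbOfFin rfl).strictMono hxy
          by_cases hx : x = p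
          · subst hx
            rw [Function.update_self, Function.update_of_ne hxy.ne']
            have hne : I.orderEmbOfFin rfl y ≠ i1 := fun e => h1 (e ▸ orderEmbOfFin_mem _ _ _)
            rw [hp] at hxy'
            refine lt_of_le_of_ne ?_ hne.symm
            rw [Fin.le_def, hi]; exact hxy'
          · rw [Function.update_of_ne hx]
            by_cases hy : y = p
            · subst hy
              rw [Function.update_self]
              rw [hp] at hxy'
              rw [Fin.lt_def] at hxy' ⊢; omega
            · rw [Function.update_of_ne hy]; exact hxy')
        rw [this]
      congr 1
      ext a b
      simp only [submatrix_apply, e3]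
      by_cases ha : a = p
      · subst ha; simp [hp]
      · have : I.orderEmbOfFin rfl a ≠ i := by
          rw [← hp]; exact fun e => ha ((I.orderEmbOfFin rfl).injective e)
        simp [Function.update_of_ne ha, updateRow_ne this]
  · rw [if_neg (by simp [h]), add_zero]
    congr 1
    ext a b
    have : I.orderEmbOfFin rfl a ≠ i := fun e => h (e ▸ orderEmbOfFin_mem _ _ _)
    simp [updateRow_ne this]

theorem gale_bump {n : ℕ} (I K : Finset (Fin n)) (hc : I.card = K.card) (hG : Gale I K)
    (hne : I ≠ K) : ∃ i i1 : Fin n, (i1 : ℕ) = i + 1 ∧ i ∈ I ∧ i1 ∉ I ∧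
      Gale (insert i1 (I.erase i)) K := by
  have hbig : ∀ z, n ≤ z → ∀ S : Finset (Fin n), cnt z S = 0 := by
    intro z hz S
    apply cnt_none
    intro j _
    exact j.2.trans_le hz
  have ex : ∃ z, cnt z I < cnt z K := by
    by_contra hcon
    push Not at hcon
    apply hne
    ext a
    have h1 := cnt_succ a I
    have h2 := cnt_succ a K
    have h3 := le_antisymm (hG a) (hcon a)
    have h4 := le_antisymm (hG (a+1)) (hcon (a+1))
    by_cases ha : a ∈ I <;> by_cases hb : a ∈ K <;> simp [ha, hb] at h1 h2 ⊢ <;> omega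
  have hz := Nat.find_spec ex
  have hmin := fun m => Nat.find_min ex (m := m)
  set z := Nat.find ex
  have hz0 : z ≠ 0 := by
    intro h0
    rw [h0, cnt_zero, cnt_zero] at hz; omega
  have hzn : z < n := by
    by_contra h
    rw [hbig z (by omega) K] at hz; omega
  have hm := hmin (z-1) (by omega)
  let S : Finset (Fin n) := univ.filter fun i : Fin n =>
    i ∈ I ∧ cnt ((i : ℕ) + 1) I < cnt ((i : ℕ) + 1) K
  have hS : S.Nonempty := by
    refine ⟨⟨z-1, by omega⟩, ?_⟩
    have h1 := cnt_succ (⟨z-1, by omega⟩ : Fin n) I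
    have h2 := cnt_succ (⟨z-1, by omega⟩ : Fin n) K
    have e : z - 1 + 1 = z := by omega
    simp only [S, mem_filter, mem_univ, true_and, e] at h1 h2 ⊢
    refine ⟨?_, hz⟩
    by_contra hni
    rw [if_neg hni] at h1
    omega
  obtain ⟨i, hiS, himax⟩ := S.exists_max_image id hS
  simp only [S, mem_filter, mem_univ, true_and, id] at hiS himax
  have hin : (i : ℕ) + 1 < n := by
    by_contra h
    have := hiS.2
    rw [hbig _ (by omega) K] at this; omega
  have hni : (⟨i + 1, hin⟩ : Fin n) ∉ I := by
    intro hmem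
    have h1 := cnt_succ (⟨i + 1, hin⟩ : Fin n) I
    have h2 := cnt_succ (⟨i + 1, hin⟩ : Fin n) K
    rw [if_pos hmem] at h1
    have h3 := himax ⟨i + 1, hin⟩ ⟨hmem, by
      have := hiS.2
      simp only at h1 h2 ⊢
      split_ifs at h2 <;> omega⟩
    rw [Fin.le_def] at h3
    simp at h3
  refine ⟨i, ⟨i + 1, hin⟩, rfl, hiS.1, hni, ?_⟩
  intro z
  have h1 : cnt z I = cnt z (I.erase i) + if z ≤ (i : ℕ) then 1 else 0 := by
    conv_lhs => rw [← insert_erase hiS.1]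
    exact cnt_insert _ _ _ (by simp)
  rw [cnt_insert _ _ _ (by simp [hni])]
  have h2 := hG z
  have h3 := hiS.2
  simp only
  by_cases hz1 : z = i + 1
  · subst hz1
    simp at h1 ⊢
    omega
  · split_ifs at h1 ⊢ <;> omega

open Filter Topology in
theorem correct {n : ℕ} (v : Equiv.Perm (Fin n)) (g : Matrix (Fin n) (Fin n) ℝ) (hS : Supp v g)
    (hp : ∀ j, g (v j) j ≠ 0) (M : ℝ → Matrix (Fin n) (Fin n) ℝ) (hM0 : M 0 = g)
    (hMc : ∀ i j, Continuous fun ε => M ε i j) (hM1 : ∀ ε i j, M ε i j ≠ 0 → i ≤ v j) :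
    ∃ G : ℝ → Matrix (Fin n) (Fin n) ℝ, (∀ i j, ContinuousAt (fun ε => G ε i j) 0) ∧ G 0 = g ∧
      ∀ᶠ ε in 𝓝 0, (Supp v (G ε) ∧ ∀ I U, Up U → I.card = U.card →
        minor (G ε) I U = minor (M ε) I U) := by
  let W : ∀ (j : Fin n), ℝ → Matrix {l // j < l ∧ v l < v j} {l // j < l ∧ v l < v j} ℝ :=
    fun j ε => of fun l m => M ε (v l) m
  let w : ∀ (j : Fin n), ℝ → {l // j < l ∧ v l < v j} → ℝ := fun j ε l => M ε (v l) j
  let β : ∀ (j : Fin n), ℝ → {l // j < l ∧ v l < v j} → ℝ := fun j ε =>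
    - ((W j ε).det⁻¹ • ((W j ε).adjugate *ᵥ w j ε))
  let b : ℝ → Matrix (Fin n) (Fin n) ℝ := fun ε => of fun l j =>
    if l = j then 1 else if h : j < l ∧ v l < v j then β j ε ⟨l, h⟩ else 0
  have hWc : ∀ j, Continuous (W j) := fun j =>
    continuous_matrix fun a c => hMc _ _
  have hwc : ∀ j, Continuous (w j) := fun j => continuous_pi fun a => hMc _ _
  have hD0 : ∀ j, (W j 0).det ≠ 0 := by
    intro j
    have : (W j 0).det = ∏ l, (W j 0) l l := by
      apply det_of_isUpperTriangular
      intro l m hml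
      by_contra hne
      have h2 : g (v l) m ≠ 0 := by rw [← hM0]; exact hne
      have := (hS _ _ h2).2
      rw [Equiv.symm_apply_apply] at this
      exact absurd hml (not_lt.2 this)
    rw [this]
    apply prod_ne_zero_iff.2
    intro l _
    have := hp l
    rw [← hM0] at this
    exact this
  have hDc : ∀ j, Continuous fun ε => (W j ε).det := fun j => (hWc j).matrix_det
  have hβc : ∀ j, ContinuousAt (β j) 0 := by
    intro j
    apply ContinuousAt.neg
    exact ContinuousAt.fun_smul ((hDc j).continuousAt.inv₀ (hD0 j))
      ((hWc j).matrix_adjugate.matrix_mulVec (hwc j)).continuousAt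
  have hw0 : ∀ j, w j 0 = 0 := by
    intro j
    ext l
    by_contra hne
    have h2 : g (v l) j ≠ 0 := by rw [← hM0]; exact hne
    have := (hS _ _ h2).2
    rw [Equiv.symm_apply_apply] at this
    exact absurd l.2.1 (not_lt.2 this)
  have hb0 : b 0 = 1 := by
    ext l j
    simp only [b, of_apply, one_apply]
    split_ifs with h1 h2
    · rfl
    · simp [β, hw0]
    · rfl
  have hbc : ∀ l j, ContinuousAt (fun ε => b ε l j) 0 := by
    intro l j
    simp only [b, of_apply]
    split_ifs with h1 h2
    · exact continuousAt_const
    · exact continuousAt_pi.1 (hβc j) ⟨l, h2⟩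
    · exact continuousAt_const
  have hb1 : ∀ ε j, b ε j j = 1 := by intro ε j; simp [b]
  have hbs : ∀ ε l j, b ε l j ≠ 0 → l = j ∨ (j < l ∧ v l < v j) := by
    intro ε l j hne
    simp only [b, of_apply] at hne
    split_ifs at hne with h1 h2
    · exact Or.inl h1
    · exact Or.inr h2
    · exact absurd rfl hne
  refine ⟨fun ε => M ε * b ε, ?_, ?_, ?_⟩
  · intro i j
    simp only [mul_apply]
    apply tendsto_finsetSum
    intro m _
    exact (hMc i m).continuousAt.mul (hbc m j)
  · simp [hb0, hM0]
  · have hev : ∀ᶠ ε in 𝓝 (0:ℝ), ∀ j, (W j ε).det ≠ 0 := by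
      rw [eventually_all]
      intro j
      exact (hDc j).continuousAt.eventually_ne (hD0 j)
    filter_upwards [hev] with ε hε
    refine ⟨?_, ?_⟩
    · intro i j hne
      constructor
      · rw [mul_apply] at hne
        obtain ⟨m, _, hm⟩ := exists_ne_zero_of_sum_ne_zero hne
        have h1 := hM1 _ _ _ (left_ne_zero_of_mul hm)
        rcases hbs _ _ _ (right_ne_zero_of_mul hm) with rfl | h2
        · exact h1
        · exact h1.trans h2.2.le
      · by_contra hlt
        rw [not_le] at hlt
        apply hne
        obtain ⟨l, rfl⟩ : ∃ l, i = v l := ⟨v.symm i, by simp⟩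
        rw [Equiv.symm_apply_apply] at hlt
        by_cases hv : v l < v j
        · have e1 : (W j ε) *ᵥ (β j ε) = - w j ε := by
            simp only [β]
            rw [mulVec_neg, mulVec_smul, mulVec_mulVec, mul_adjugate, smul_mulVec, one_mulVec,
              smul_smul, inv_mul_cancel₀ (hε j), one_smul]
          have e2 := congrFun e1 ⟨l, hlt, hv⟩
          simp only [mulVec, dotProduct, Pi.neg_apply] at e2
          rw [mul_apply, ← add_sum_erase _ _ (mem_univ j), hb1, mul_one]
          have e3 : ∑ x ∈ univ.erase j, M ε (v l) x * b ε x j =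
              ∑ x ∈ univ.filter (fun x => j < x ∧ v x < v j), M ε (v l) x * b ε x j := by
            symm
            apply sum_subset
            · intro x hx
              rw [mem_filter] at hx
              rw [mem_erase]
              exact ⟨hx.2.1.ne', mem_univ _⟩
            · intro x hx hx2
              by_contra hne2
              rw [mem_erase] at hx
              apply hx2
              rw [mem_filter]
              exact ⟨mem_univ _, (hbs _ _ _ (right_ne_zero_of_mul hne2)).resolve_left hx.1⟩
          rw [e3, ← sum_subtype_eq_sum_filter]
          have e4 : (∑ x ∈ Finset.subtype (fun x => j < x ∧ v x < v j) univ,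
              M ε (v l) x * b ε x j) = ∑ x, W j ε ⟨l, hlt, hv⟩ x * β j ε x := by
            rw [subtype_univ]
            apply sum_congr rfl
            intro x _
            simp only [W, b, of_apply]
            rw [if_neg x.2.1.ne', dif_pos x.2]
          rw [e4, e2]
          simp [w]
        · rw [mul_apply]
          apply sum_eq_zero
          intro m _
          by_contra hm
          have h1 := hM1 _ _ _ (left_ne_zero_of_mul hm)
          have h3 : v m ≤ v j := by
            rcases hbs _ _ _ (right_ne_zero_of_mul hm) with rfl | h2
            · exact le_rfl
            · exact h2.2.le
          have h4 : v l = v j := le_antisymm (h1.trans h3) (not_lt.1 hv)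
          exact hlt.ne' (v.injective h4)
    · intro I U hU hc
      exact minor_lower _ _ (hb1 ε) (fun l j h => by
        rcases hbs _ _ _ h with rfl | h2
        · exact le_rfl
        · exact h2.1.le) I U hU hc

def RN {n : ℕ} (g : Matrix (Fin n) (Fin n) ℝ) : Prop :=
  ∀ U, Up U → ∀ I : Finset (Fin n), I.card = U.card → 0 ≤ minor g I U

def VP {n : ℕ} (v : Equiv.Perm (Fin n)) (g : Matrix (Fin n) (Fin n) ℝ) : Prop :=
  ∀ U, Up U → 0 < minor g (vm v U) U

def zs {n : ℕ} (v : Equiv.Perm (Fin n)) (g : Matrix (Fin n) (Fin n) ℝ) :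
    Finset (Finset (Fin n) × Finset (Fin n)) :=
  univ.filter fun p => Up p.2 ∧ p.1.card = p.2.card ∧ Gale p.1 (vm v p.2) ∧ minor g p.1 p.2 = 0

theorem pivot_ne {n : ℕ} {v : Equiv.Perm (Fin n)} {g : Matrix (Fin n) (Fin n) ℝ}
    (hS : Supp v g) (hV : VP v g) (j : Fin n) : g (v j) j ≠ 0 := by
  have hj : j ∉ univ.filter (fun x => j < x) := by simp
  have h := hV (insert j (univ.filter fun x => j < x)) (by
    intro x hx y hxy
    simp only [mem_insert, mem_filter, mem_univ, true_and] at hx ⊢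
    rcases hx with rfl | hx
    · exact hxy.eq_or_lt.imp Eq.symm id
    · exact Or.inr (hx.trans_le hxy))
  rw [vm_insert, minor_insert_col _ _ _ _ _ (by rw [mem_vm]; simp) hj (card_vm _ _)] at h
  · intro h0
    rw [h0] at h
    simp at h
  · intro i hi
    rw [mem_vm, mem_filter] at hi
    by_contra hne
    exact absurd hi.2 (not_lt.2 (hS _ _ hne).2)

theorem continuousAt_minor {n : ℕ} (G : ℝ → Matrix (Fin n) (Fin n) ℝ)
    (hG : ∀ i j, ContinuousAt (fun ε => G ε i j) 0) (I J : Finset (Fin n)) :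
    ContinuousAt (fun ε => minor (G ε) I J) 0 := by
  unfold minor
  split_ifs with h
  · simp only [det_apply', of_apply]
    apply tendsto_finsetSum
    intro σ _
    apply Filter.Tendsto.mul tendsto_const_nhds
    apply tendsto_finsetProd
    intro i _
    exact hG _ _
  · exact continuousAt_const

open Filter Topology in
theorem coreC {n : ℕ} (v : Equiv.Perm (Fin n)) : ∀ (k : ℕ) (g : Matrix (Fin n) (Fin n) ℝ),
    (zs v g).card = k → Supp v g → VP v g → RN g → TopFlagNonneg g := by
  intro k
  induction k using Nat.strong_induction_on with
  | _ k ih =>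
  intro g hk hS hV hR
  by_cases hne : (zs v g).Nonempty
  · obtain ⟨⟨I, U⟩, hIU, hmax⟩ := (zs v g).exists_max_image
      (fun p => ∑ i ∈ p.1, (i : ℕ)) hne
    simp only [zs, mem_filter, mem_univ, true_and] at hIU hmax
    obtain ⟨hU, hc, hG, h0⟩ := hIU
    have hIne : I ≠ vm v U := by
      rintro rfl
      exact (hV U hU).ne' h0
    obtain ⟨i, i1, hi1, hiI, hi1I, hG'⟩ := gale_bump I (vm v U) (by rw [card_vm, hc]) hG hIne
    have hc' : (insert i1 (I.erase i)).card = U.card := by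
      rw [card_insert_of_notMem (by simp [hi1I]), card_erase_add_one hiI, hc]
    have hpos : 0 < minor g (insert i1 (I.erase i)) U := by
      refine lt_of_le_of_ne (hR U hU _ hc') fun e => ?_
      have := hmax (insert i1 (I.erase i), U) ⟨hU, hc', hG', e.symm⟩
      simp only at this
      rw [sum_insert (by simp [hi1I]), ← add_sum_erase I _ hiI] at this
      omega
    let M : ℝ → Matrix (Fin n) (Fin n) ℝ := fun ε => updateRow g i (g i + ε • g i1)
    obtain ⟨G, hGc, hG0, hGe⟩ := correct v g hS (pivot_ne hS hV) M (by simp [M])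
      (by
        intro a c
        by_cases ha : a = i
        · subst ha; simp only [M, updateRow_self, Pi.add_apply, Pi.smul_apply, smul_eq_mul]
          fun_prop
        · simp only [M, updateRow_ne ha]; exact continuous_const)
      (by
        intro ε a c hac
        by_cases ha : a = i
        · subst ha
          simp only [M, updateRow_self, Pi.add_apply, Pi.smul_apply, smul_eq_mul] at hac
          by_cases h1 : g a c = 0
          · rw [h1, zero_add] at hac
            have := (hS _ _ (right_ne_zero_of_mul hac)).1
            rw [Fin.le_def] at this ⊢
            omega
          · exact (hS _ _ h1).1
        · simp only [M, updateRow_ne ha] at hac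
          exact (hS _ _ hac).1)
    have hT : ∀ᶠ ε in 𝓝[>] (0:ℝ), TopFlagNonneg (G ε) := by
      filter_upwards [hGe.filter_mono nhdsWithin_le_nhds, self_mem_nhdsWithin] with ε hε hε0
      obtain ⟨hSε, hmin⟩ := hε
      have hε0 : 0 < ε := hε0
      have hge : ∀ I' U', Up U' → I'.card = U'.card → minor g I' U' ≤ minor (G ε) I' U' := by
        intro I' U' hU' hc2
        rw [hmin I' U' hU' hc2, minor_row g i i1 hi1 ε I' U' hc2]
        split_ifs with hh
        · have := hR U' hU' (insert i1 (I'.erase i)) (by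
            rw [card_insert_of_notMem (by simp [hh.2]), card_erase_add_one hh.1, hc2])
          have := mul_nonneg hε0.le this
          linarith
        · simp
      have hRε : RN (G ε) := fun U' hU' I' hc2 => (hR U' hU' I' hc2).trans (hge I' U' hU' hc2)
      have hVε : VP v (G ε) := fun U' hU' => (hV U' hU').trans_le (hge _ U' hU' (card_vm _ _))
      refine ih _ ?_ (G ε) rfl hSε hVε hRε
      rw [← hk]
      apply card_lt_card
      rw [ssubset_iff_of_subset]
      · refine ⟨(I, U), by simp [zs, hU, hc, hG, h0], ?_⟩
        simp only [zs, mem_filter, mem_univ, true_and]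
        rintro ⟨_, _, _, h⟩
        rw [hmin I U hU hc, minor_row g i i1 hi1 ε I U hc, h0, if_pos ⟨hiI, hi1I⟩, zero_add] at h
        exact (mul_pos hε0 hpos).ne' h
      · rintro ⟨I', U'⟩ hp
        simp only [zs, mem_filter, mem_univ, true_and] at hp ⊢
        refine ⟨hp.1, hp.2.1, hp.2.2.1, ?_⟩
        exact le_antisymm ((hge I' U' hp.1 hp.2.1).trans hp.2.2.2.le) (hR U' hp.1 I' hp.2.1)
    intro J
    have hcont := continuousAt_minor G hGc (univ.filter fun i : Fin n => (i : ℕ) < J.card) J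
    have ht : Tendsto (fun ε => minor (G ε) (univ.filter fun i : Fin n => (i : ℕ) < J.card) J)
        (𝓝[>] 0) (𝓝 (minor (G 0) (univ.filter fun i : Fin n => (i : ℕ) < J.card) J)) :=
      hcont.tendsto.mono_left nhdsWithin_le_nhds
    rw [hG0] at ht
    exact ge_of_tendsto ht (hT.mono fun ε h => h J)
  · rw [not_nonempty_iff_eq_empty] at hne
    have hRP : RP v univ g := by
      intro U _ hup I _ hc hG
      have hU : Up U := fun x hx y hxy => hup x hx y (mem_univ _) hxy
      refine lt_of_le_of_ne (hR U hU I hc) fun e => ?_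
      have : (I, U) ∈ zs v g := by simp [zs, hU, hc, hG, ← e]
      rw [hne] at this
      simp at this
    have hTP := RP_imp_TP v _ univ rfl g hS hRP
    intro J
    let L : Finset (Fin n) := univ.filter fun x : Fin n => (v x : ℕ) < J.card
    have hL : vm v L = univ.filter fun i : Fin n => (i : ℕ) < J.card := by
      ext x; rw [mem_vm]; simp [L]
    have hJn : J.card ≤ n := by simpa using card_le_univ J
    have hLc : J.card = L.card := by
      rw [← card_vm v L, hL, Fin.card_filter_val_lt]
      exact (min_eq_right hJn).symm
    rw [← hL]
    by_cases hG : Gale L J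
    · refine (hTP L ⟨subset_univ _, ?_⟩ J (subset_univ _) hLc hG).le
      intro x hx y _ hxy
      simp only [L, mem_filter, mem_univ, true_and] at hx ⊢
      rw [Fin.le_def] at hxy
      omega
    · rw [minor_zero hS L J hLc hG]

theorem card_right {n c : ℕ} (hc : c ≤ n) :
    (univ.filter fun j : Fin n => n - c ≤ (j : ℕ)).card = c := by
  have h := card_filter_add_card_filter_not (s := (univ : Finset (Fin n)))
    (fun j : Fin n => n - c ≤ (j : ℕ))
  have h2 : (univ.filter fun j : Fin n => ¬ n - c ≤ (j : ℕ)) =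
    univ.filter fun j : Fin n => (j : ℕ) < n - c := by
    ext x; simp only [mem_filter, mem_univ, true_and, not_le]
  rw [h2, Fin.card_filter_val_lt, card_univ, Fintype.card_fin] at h
  omega

theorem up_eq {n : ℕ} (U : Finset (Fin n)) (hU : Up U) :
    U = univ.filter fun j : Fin n => n - U.card ≤ (j : ℕ) := by
  have hn : U.card ≤ n := by simpa using card_le_univ U
  apply eq_of_subset_of_card_le
  · intro x hx
    simp only [mem_filter, mem_univ, true_and]
    have h1 : Finset.Ici x ⊆ U := fun y hy => hU x hx y (by simpa using hy)
    have h2 := card_le_card h1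
    rw [Fin.card_Ici] at h2
    omega
  · rw [card_right hn]

theorem rn_of_right {n : ℕ} {g : Matrix (Fin n) (Fin n) ℝ} (h : RightFlagNonneg g) : RN g := by
  intro U hU I hc
  rw [up_eq U hU, ← hc]
  exact h I

theorem minor_diag {n : ℕ} {v : Equiv.Perm (Fin n)} {g : Matrix (Fin n) (Fin n) ℝ}
    (hS : Supp v g) (U : Finset (Fin n)) : minor g (vm v U) U =
      ∏ j ∈ U, ((-1) ^ (U.filter fun k => j < k ∧ v k < v j).card * g (v j) j) := by
  induction U using Finset.induction_on_min with
  | empty =>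
    have : vm v (∅ : Finset (Fin n)) = ∅ := rfl
    rw [this, minor_empty]; simp
  | insert c U hc ih =>
    have hcU : c ∉ U := fun h => lt_irrefl _ (hc c h)
    rw [vm_insert, minor_insert_col _ _ _ _ _ (by rw [mem_vm]; simpa using hcU) hcU (card_vm _ _),
      prod_insert hcU, ih]
    · congr 1
      · congr 2
        have h1 : (U.filter fun x => x < c) = ∅ :=
          filter_false_of_mem fun x hx => not_lt.2 (hc x hx).le
        rw [h1, card_empty, add_zero, vm, filter_map, card_map]
        congr 1
        ext x
        simp only [mem_filter, mem_insert, Function.comp]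
        constructor
        · rintro ⟨h1, h2⟩; exact ⟨Or.inr h1, hc x h1, h2⟩
        · rintro ⟨h1 | h1, h2, h3⟩
          · exact absurd h2 (by simp [h1])
          · exact ⟨h1, h3⟩
      · apply prod_congr rfl
        intro j hj
        congr 3
        ext x
        simp only [mem_filter, mem_insert]
        constructor
        · rintro ⟨h1, h2⟩; exact ⟨Or.inr h1, h2⟩
        · rintro ⟨h1 | h1, h2, h3⟩
          · subst h1; exact absurd h2 (not_lt.2 (hc j hj).le)
          · exact ⟨h1, h2, h3⟩
    · intro i hi
      rw [mem_vm] at hi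
      by_contra hne
      exact absurd (hc _ hi) (not_lt.2 (hS _ _ hne).2)

theorem minor_diag_one {n : ℕ} {v : Equiv.Perm (Fin n)} {g : Matrix (Fin n) (Fin n) ℝ}
    (hS : Supp v g)
    (hp : ∀ j, g (v j) j = (-1) ^ (univ.filter fun k => j < k ∧ v k < v j).card)
    (U : Finset (Fin n)) (hU : ∀ j ∈ U, ∀ k, j < k → v k < v j → k ∈ U) :
    minor g (vm v U) U = 1 := by
  rw [minor_diag hS]
  apply prod_eq_one
  intro j hj
  have : (U.filter fun k => j < k ∧ v k < v j) = univ.filter fun k => j < k ∧ v k < v j := by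
    ext k
    simp only [mem_filter, mem_univ, true_and]
    exact ⟨fun h => h.2, fun h => ⟨hU j hj k h.1 h.2, h⟩⟩
  rw [this, hp, ← pow_add, ← two_mul, pow_mul]
  norm_num

def gT {n : ℕ} (g : Matrix (Fin n) (Fin n) ℝ) : Matrix (Fin n) (Fin n) ℝ :=
  of fun i j => g (Fin.rev j) (Fin.rev i)

def rv {n : ℕ} (I : Finset (Fin n)) : Finset (Fin n) := I.map Fin.revPerm.toEmbedding

theorem mem_rv {n : ℕ} {I : Finset (Fin n)} {x : Fin n} : x ∈ rv I ↔ Fin.rev x ∈ I := by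
  unfold rv; rw [mem_map_equiv]; rfl

theorem card_rv {n : ℕ} (I : Finset (Fin n)) : (rv I).card = I.card := card_map _

theorem rv_rv {n : ℕ} (I : Finset (Fin n)) : rv (rv I) = I := by
  ext x; simp [mem_rv]

theorem emb_rv {n k : ℕ} (I : Finset (Fin n)) (h : I.card = k) (p : Fin k) :
    (rv I).orderEmbOfFin ((card_rv I).trans h) p = Fin.rev (I.orderEmbOfFin h (Fin.rev p)) := by
  have := orderEmbOfFin_unique ((card_rv I).trans h)
    (f := fun p => Fin.rev (I.orderEmbOfFin h (Fin.rev p))) (by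
      intro x; rw [mem_rv, Fin.rev_rev]; exact orderEmbOfFin_mem _ _ _) (by
      intro x y hxy
      simp only [Fin.rev_lt_rev]
      exact (I.orderEmbOfFin h).strictMono (Fin.rev_lt_rev.2 hxy))
  exact (congrFun this p).symm

theorem minor_gT {n : ℕ} (g : Matrix (Fin n) (Fin n) ℝ) (I J : Finset (Fin n))
    (h : I.card = J.card) : minor (gT g) I J = minor g (rv J) (rv I) := by
  rw [minor_eq _ I J rfl h.symm, minor_eq _ (rv J) (rv I) ((card_rv J).trans h.symm)
    ((card_rv I).trans rfl)]
  rw [← det_transpose, ← det_submatrix_equiv_self Fin.revPerm]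
  congr 1
  ext p q
  simp [gT, emb_rv, emb_rv J h.symm]

theorem supp_gT {n : ℕ} {v : Equiv.Perm (Fin n)} {g : Matrix (Fin n) (Fin n) ℝ}
    (hS : Supp v g) : Supp (Fin.revPerm * v⁻¹ * Fin.revPerm) (gT g) := by
  intro i j hne
  have h := hS _ _ hne
  have e1 : (Fin.revPerm * v⁻¹ * Fin.revPerm : Equiv.Perm (Fin n)) j =
    Fin.rev (v.symm (Fin.rev j)) := rfl
  have e2 : (Fin.revPerm * v⁻¹ * Fin.revPerm : Equiv.Perm (Fin n)).symm i =
    Fin.rev (v (Fin.rev i)) := rfl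
  rw [e1, e2]
  constructor
  · exact Fin.le_rev_iff.2 h.2
  · exact Fin.rev_le_iff.2 h.1

theorem flags {n : ℕ} (v : Equiv.Perm (Fin n)) (g : Matrix (Fin n) (Fin n) ℝ) (hS : Supp v g)
    (hp : ∀ j, g (v j) j = (-1) ^ (univ.filter fun k => j < k ∧ v k < v j).card) :
    RightFlagNonneg g ↔ TopFlagNonneg g := by
  constructor
  · intro h
    refine coreC v _ g rfl hS ?_ (rn_of_right h)
    intro U hU
    rw [minor_diag_one hS hp U fun j hj k hjk _ => hU j hj k hjk.le]
    norm_num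
  · intro h
    have hcn : ∀ I : Finset (Fin n), I.card ≤ n := fun I => by simpa using card_le_univ I
    have hrv1 : ∀ c, c ≤ n → rv (univ.filter fun j : Fin n => n - c ≤ (j : ℕ)) =
        univ.filter fun i : Fin n => (i : ℕ) < c := by
      intro c hc
      ext x
      rw [mem_rv]
      simp only [mem_filter, mem_univ, true_and, Fin.val_rev]
      omega
    have hrv2 : ∀ c, c ≤ n → rv (univ.filter fun i : Fin n => (i : ℕ) < c) =
        (univ.filter fun j : Fin n => n - c ≤ (j : ℕ)) := by
      intro c hc
      rw [← hrv1 c hc, rv_rv]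
    have hR : RightFlagNonneg (gT g) := by
      intro I
      rw [minor_gT _ _ _ (card_right (hcn I)).symm, hrv1 _ (hcn I), ← card_rv I]
      exact h (rv I)
    have hT : TopFlagNonneg (gT g) := by
      refine coreC (Fin.revPerm * v⁻¹ * Fin.revPerm) _ (gT g) rfl (supp_gT hS) ?_ (rn_of_right hR)
      intro U hU
      rw [minor_gT _ _ _ (card_vm _ _)]
      have e : rv U = vm v (rv (vm (Fin.revPerm * v⁻¹ * Fin.revPerm) U)) := by
        ext x
        rw [mem_rv, mem_vm, mem_rv, mem_vm]
        have e2 : ∀ i, (Fin.revPerm * v⁻¹ * Fin.revPerm : Equiv.Perm (Fin n)).symm i =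
          Fin.rev (v (Fin.rev i)) := fun i => rfl
        rw [e2]
        simp
      have hlow : ∀ x ∈ rv U, ∀ y, y ≤ x → y ∈ rv U := by
        intro x hx y hxy
        rw [mem_rv] at hx ⊢
        exact hU _ hx _ (Fin.rev_le_rev.2 hxy)
      set L := rv (vm (Fin.revPerm * v⁻¹ * Fin.revPerm) U)
      rw [e] at hlow ⊢
      rw [minor_diag_one hS hp L]
      · norm_num
      · intro j hj k _ hvk
        have := hlow (v j) (by rw [mem_vm]; simpa using hj) (v k) hvk.le
        rw [mem_vm] at this
        simpa using this
    intro I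
    have hI := hT (rv I)
    rw [minor_gT _ _ _ (by
      rw [Fin.card_filter_val_lt]; exact min_eq_right (hcn _)), rv_rv, card_rv,
      hrv2 _ (hcn I)] at hI
    exact hI

theorem pdot_facts {n : ℕ} (hn : 1 ≤ n) (v : Equiv.Perm (Fin n)) (g : Matrix (Fin n) (Fin n) ℝ)
    (h1 : IsN (g * (pdot v)⁻¹)) (h2 : IsN ((pdot v)⁻¹ * g)) : Supp v g ∧
    ∀ j, g (v j) j = (-1) ^ (univ.filter fun k => j < k ∧ v k < v j).card := by
  have hu : IsUnit (pdot v : Matrix (Fin n) (Fin n) ℝ).det := by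
    by_contra hno
    have h3 := h1.1 ⟨0, hn⟩
    rw [nonsing_inv_apply_not_isUnit _ hno] at h3
    simp at h3
  have e1 : g = (g * (pdot v)⁻¹) * pdot v := by
    rw [Matrix.mul_assoc, nonsing_inv_mul _ hu, Matrix.mul_one]
  have e2 : g = pdot v * ((pdot v)⁻¹ * g) := by
    rw [← Matrix.mul_assoc, mul_nonsing_inv _ hu, Matrix.one_mul]
  have f1 : ∀ i j, g i j = (g * (pdot v : Matrix (Fin n) (Fin n) ℝ)⁻¹) i (v j) *
      (-1) ^ (univ.filter fun k => j < k ∧ v k < v j).card := by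
    intro i j
    conv_lhs => rw [e1, mul_apply]
    rw [sum_eq_single (v j)]
    · congr 1
      simp [pdot]
    · intro b _ hb
      simp [pdot, hb]
    · simp
  have f2 : ∀ i j, g i j = (-1) ^ (univ.filter fun k => v.symm i < k ∧ v k < i).card *
      ((pdot v : Matrix (Fin n) (Fin n) ℝ)⁻¹ * g) (v.symm i) j := by
    intro i j
    conv_lhs => rw [e2, mul_apply]
    rw [sum_eq_single (v.symm i)]
    · congr 1
      simp [pdot]
    · intro b _ hb
      have : i ≠ v b := fun e => hb (by simp [e])
      simp [pdot, this]
    · simp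
  refine ⟨?_, ?_⟩
  · intro i j hne
    constructor
    · rw [f1] at hne
      by_contra hlt
      exact left_ne_zero_of_mul hne (h1.2 _ _ (not_le.1 hlt))
    · rw [f2] at hne
      by_contra hlt
      exact right_ne_zero_of_mul hne (h2.2 _ _ (not_le.1 hlt))
  · intro j
    rw [f1, h1.1, one_mul]

/-- the chiral map preserves total positivity (type A). -/
theorem statement_0 {n : ℕ} (hn : 1 ≤ n) (v : Equiv.Perm (Fin n))
    (g : Matrix (Fin n) (Fin n) ℝ) (hdet : g.det = 1)
    (h1 : IsN (g * (pdot v : Matrix (Fin n) (Fin n) ℝ)⁻¹))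
    (h2 : IsN ((pdot v : Matrix (Fin n) (Fin n) ℝ)⁻¹ * g)) :
    RightFlagNonneg g ↔ TopFlagNonneg g := by
  obtain ⟨hS, hp⟩ := pdot_facts hn v g h1 h2
  exact flags v g hS hp

end
end Paper
end

section
/- Let v, w be permutations of {1,…,n} and let g ∈ SL(n,ℂ) satisfy g ∈ B₋wB₋ and g·v̇⁻¹ ∈ N. Then: (1) gᵀ·ẇ admits a UDL factorization, so h := v̇·[gᵀẇ]_L^+ is defined; (2) h ∈ B₋wB₋ and v̇⁻¹·h ∈ N; (3) ẇ·hᵀ admits an LDU factorization and [ẇhᵀ]_R^+·v̇ = g. Consequently, the map g ↦ v̇·[gᵀẇ]_L^+ is a bijection from B₋wB₋ ∩ N·v̇ onto B₋wB₋ ∩ v̇·N, with inverse h ↦ [ẇhᵀ]_R^+·v̇. -/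
open Matrix Finset

namespace Paper

open scoped Classical

noncomputable section

variable {K : Type*} [Field K] {n m : ℕ}

section helpers
variable {A B P Q x : Matrix (Fin n) (Fin n) K}

lemma IsBm.tri (h : IsBm A) : BlockTriangular A (OrderDual.toDual : Fin n → (Fin n)ᵒᵈ) :=
  fun i j hij => h.2 i j (OrderDual.toDual_lt_toDual.1 hij)

lemma IsBm.mul (hA : IsBm A) (hB : IsBm B) : IsBm (A * B) := by
  refine ⟨by rw [det_mul, hA.1, hB.1, one_mul], fun i j hij => ?_⟩
  exact (hA.tri.mul hB.tri) (OrderDual.toDual_lt_toDual.2 hij)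

lemma IsBm.inv (hA : IsBm A) : IsBm A⁻¹ := by
  have hu : IsUnit A.det := by rw [hA.1]; exact isUnit_one
  letI := Matrix.invertibleOfIsUnitDet A hu
  refine ⟨by rw [det_nonsing_inv, hA.1, Ring.inverse_one], fun i j hij => ?_⟩
  exact (blockTriangular_inv_of_blockTriangular hA.tri) (OrderDual.toDual_lt_toDual.2 hij)

lemma IsBm.transpose (hA : IsBm A) : IsB Aᵀ :=
  ⟨by rw [det_transpose, hA.1], fun i j h => hA.2 j i h⟩

lemma IsB.transpose (hA : IsB A) : IsBm Aᵀ :=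
  ⟨by rw [det_transpose, hA.1], fun i j h => hA.2 j i h⟩

lemma IsB.mul (hA : IsB A) (hB : IsB B) : IsB (A * B) := by
  have := (hB.transpose.mul hA.transpose).transpose
  simpa using this

lemma IsB.inv (hA : IsB A) : IsB A⁻¹ := by
  have := hA.transpose.inv.transpose
  simpa [transpose_nonsing_inv] using this

lemma IsN.transpose (hA : IsN A) : IsNm Aᵀ := ⟨fun i => hA.1 i, fun i j h => hA.2 j i h⟩
lemma IsNm.transpose (hA : IsNm A) : IsN Aᵀ := ⟨fun i => hA.1 i, fun i j h => hA.2 j i h⟩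
lemma IsH.transpose (hA : IsH A) : IsH Aᵀ :=
  ⟨by rw [det_transpose, hA.1], fun i j h => hA.2 j i h.symm⟩

lemma IsN.isB (hA : IsN A) : IsB A := by
  refine ⟨?_, hA.2⟩
  rw [det_of_upperTriangular (fun i j h => hA.2 i j h)]
  simp [hA.1]

lemma IsNm.isBm (hA : IsNm A) : IsBm A := by simpa using hA.transpose.isB.transpose

lemma IsH.isB (hA : IsH A) : IsB A := ⟨hA.1, fun i j h => hA.2 i j h.ne'⟩
lemma IsH.isBm (hA : IsH A) : IsBm A := ⟨hA.1, fun i j h => hA.2 i j h.ne⟩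

lemma IsB.diag_mul (hA : IsB A) (hB : IsB B) (i : Fin n) : (A * B) i i = A i i * B i i := by
  rw [mul_apply]
  refine Finset.sum_eq_single i (fun j _ hj => ?_) (by simp)
  rcases lt_or_gt_of_ne hj with h | h
  · rw [hA.2 i j h, zero_mul]
  · rw [hB.2 j i h, mul_zero]

lemma IsB.mul_inv (hA : IsB A) : A * A⁻¹ = 1 :=
  Matrix.mul_nonsing_inv _ (by rw [hA.1]; exact isUnit_one)
lemma IsB.inv_mul (hA : IsB A) : A⁻¹ * A = 1 :=
  Matrix.nonsing_inv_mul _ (by rw [hA.1]; exact isUnit_one)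
lemma IsBm.mul_inv (hA : IsBm A) : A * A⁻¹ = 1 :=
  Matrix.mul_nonsing_inv _ (by rw [hA.1]; exact isUnit_one)
lemma IsBm.inv_mul (hA : IsBm A) : A⁻¹ * A = 1 :=
  Matrix.nonsing_inv_mul _ (by rw [hA.1]; exact isUnit_one)

lemma IsN.mul (hA : IsN A) (hB : IsN B) : IsN (A * B) :=
  ⟨fun i => by rw [hA.isB.diag_mul hB.isB, hA.1, hB.1, one_mul], (hA.isB.mul hB.isB).2⟩

lemma IsN.inv (hA : IsN A) : IsN A⁻¹ := by
  refine ⟨fun i => ?_, hA.isB.inv.2⟩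
  have := hA.isB.diag_mul hA.isB.inv i
  rw [hA.isB.mul_inv, hA.1, one_mul, one_apply_eq] at this
  exact this.symm

lemma IsN.eq_one (hA : IsN A) (h : IsBm A) : A = 1 := by
  ext i j
  rcases lt_trichotomy i j with hij | hij | hij
  · rw [h.2 i j hij, one_apply_ne hij.ne]
  · rw [hij, hA.1, one_apply_eq]
  · rw [hA.2 i j hij, one_apply_ne hij.ne']

/-- Uniqueness, unipotent factor on the right. -/
lemma uniq_right (hP : IsBm P) (hQ : IsBm Q) (hA : IsN A) (hB : IsN B)
    (h : P * A = Q * B) : A = B := by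
  have e : Q⁻¹ * P = B * A⁻¹ := by
    have : Q⁻¹ * (P * A) * A⁻¹ = Q⁻¹ * (Q * B) * A⁻¹ := by rw [h]
    rwa [← mul_assoc Q⁻¹ Q, hQ.inv_mul, one_mul, mul_assoc, mul_assoc, hA.isB.mul_inv,
      mul_one] at this
  have h1 : B * A⁻¹ = 1 := (hB.mul hA.inv).eq_one (e ▸ hQ.inv.mul hP)
  have : B * A⁻¹ * A = A := by rw [h1, one_mul]
  rw [mul_assoc, hA.isB.inv_mul, mul_one] at this
  exact this.symm

/-- Uniqueness, unipotent factor on the left. -/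
lemma uniq_left (hP : IsBm P) (hQ : IsBm Q) (hA : IsN A) (hB : IsN B)
    (h : A * P = B * Q) : A = B := by
  have e : P * Q⁻¹ = A⁻¹ * B := by
    have : A⁻¹ * (A * P) * Q⁻¹ = A⁻¹ * (B * Q) * Q⁻¹ := by rw [h]
    rwa [← mul_assoc A⁻¹ A, hA.isB.inv_mul, one_mul, mul_assoc, mul_assoc, hQ.mul_inv,
      mul_one] at this
  have h1 : A⁻¹ * B = 1 := (hA.inv.mul hB).eq_one (e ▸ hP.mul hQ.inv)
  have : A * (A⁻¹ * B) = A := by rw [h1, mul_one]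
  rw [← mul_assoc, hA.isB.mul_inv, one_mul] at this
  exact this.symm

lemma IsB.diag_ne (hP : IsB P) (i : Fin n) : P i i ≠ 0 := by
  intro h
  have := hP.1
  rw [det_of_upperTriangular (fun i j h => hP.2 i j h),
    Finset.prod_eq_zero (f := fun i => P i i) (Finset.mem_univ i) h] at this
  exact zero_ne_one this

lemma isH_diag (hP : IsB P) : IsH (diagonal fun i => P i i) := by
  refine ⟨?_, fun i j h => diagonal_apply_ne _ h⟩
  rw [det_diagonal, ← det_of_upperTriangular (fun i j h => hP.2 i j h), hP.1]

lemma exists_UD (hP : IsB P) : ∃ a b, IsN a ∧ IsH b ∧ P = a * b := by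
  refine ⟨P * diagonal fun i => (P i i)⁻¹, diagonal fun i => P i i, ⟨fun i => ?_, fun i j h => ?_⟩,
    isH_diag hP, ?_⟩
  · rw [mul_diagonal, mul_inv_cancel₀ (hP.diag_ne i)]
  · rw [mul_diagonal, hP.2 i j h, zero_mul]
  · rw [mul_assoc, diagonal_mul_diagonal]
    simp [hP.diag_ne]

lemma exists_DU (hP : IsB P) : ∃ b a, IsH b ∧ IsN a ∧ P = b * a := by
  refine ⟨diagonal fun i => P i i, (diagonal fun i => (P i i)⁻¹) * P,
    isH_diag hP, ⟨fun i => ?_, fun i j h => ?_⟩, ?_⟩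
  · rw [diagonal_mul, inv_mul_cancel₀ (hP.diag_ne i)]
  · rw [diagonal_mul, hP.2 i j h, mul_zero]
  · rw [← mul_assoc, diagonal_mul_diagonal]
    simp [hP.diag_ne]

lemma exists_LD (hP : IsBm P) : ∃ a b, IsNm a ∧ IsH b ∧ P = a * b := by
  obtain ⟨b, a, hb, ha, h⟩ := exists_DU hP.transpose
  exact ⟨aᵀ, bᵀ, ha.transpose, hb.transpose, by rw [← transpose_mul, ← h, transpose_transpose]⟩

lemma exists_DL (hP : IsBm P) : ∃ b a, IsH b ∧ IsNm a ∧ P = b * a := by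
  obtain ⟨b, a, hb, ha, h⟩ := exists_UD hP.transpose
  exact ⟨aᵀ, bᵀ, ha.transpose, hb.transpose, by rw [← transpose_mul, ← h, transpose_transpose]⟩

/-- The pattern algebra of a permutation. -/
def Pat (w : Equiv.Perm (Fin n)) (x : Matrix (Fin n) (Fin n) K) : Prop :=
  ∀ i j, w i < w j → x i j = 0

lemma Pat.tri {w : Equiv.Perm (Fin n)} (h : Pat w x) :
    BlockTriangular x (fun i => OrderDual.toDual (w i)) :=
  fun i j hij => h i j (OrderDual.toDual_lt_toDual.1 hij)

lemma Pat.mul {w : Equiv.Perm (Fin n)} (hA : Pat w A) (hB : Pat w B) : Pat w (A * B) :=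
  fun _ _ hij => (hA.tri.mul hB.tri) (OrderDual.toDual_lt_toDual.2 hij)

lemma Pat.inv {w : Equiv.Perm (Fin n)} (hA : Pat w A) (hu : IsUnit A.det) : Pat w A⁻¹ := by
  letI := Matrix.invertibleOfIsUnitDet A hu
  exact fun _ _ hij =>
    (blockTriangular_inv_of_blockTriangular hA.tri) (OrderDual.toDual_lt_toDual.2 hij)

lemma Pat.det {w : Equiv.Perm (Fin n)} (hA : Pat w A) : A.det = ∏ i, A i i := by
  rw [← det_submatrix_equiv_self w.symm A, det_of_lowerTriangular]
  · exact Equiv.prod_comp w.symm (fun i => A i i)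
  · intro i j hij
    exact hA _ _ (by simpa using hij)

/-- UL factorization inside the pattern algebra. -/
lemma Pat.factor {w : Equiv.Perm (Fin n)} (hx : Pat w x) (hd : x.det = 1) :
    ∃ p q, IsN p ∧ Pat w p ∧ IsBm q ∧ x * q = p := by
  have hne : ∀ i, x i i ≠ 0 := fun i h => by
    rw [hx.det, Finset.prod_eq_zero (f := fun i => x i i) (Finset.mem_univ i) h] at hd
    exact zero_ne_one hd
  have key : ∀ j : Fin n, ∃ c : Fin n → K, (∀ i, i < j → c i = 0) ∧ (∀ i, w i < w j → c i = 0) ∧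
      ∀ k, j ≤ k → ∑ i, x k i * c i = if k = j then 1 else 0 := by
    intro j
    let X : Matrix (Fin n) (Fin n) K := of fun k i =>
      if j ≤ k ∧ j ≤ i then x k i else if k = i then 1 else 0
    have hX : Pat w X := by
      intro a b hab
      have : a ≠ b := by rintro rfl; exact lt_irrefl _ hab
      simp [X, hx a b hab, this]
    have hXd : IsUnit X.det := by
      rw [hX.det, isUnit_iff_ne_zero, Finset.prod_ne_zero_iff]
      intro a _
      by_cases h : j ≤ a <;> simp [X, h, hne]
    have hXX : X * X⁻¹ = 1 := Matrix.mul_nonsing_inv _ hXd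
    have hz : ∀ i, i < j → X⁻¹ i j = 0 := by
      intro i hi
      have h1 : (X * X⁻¹) i j = 0 := by rw [hXX, one_apply_ne hi.ne]
      rw [mul_apply, Finset.sum_eq_single i] at h1
      · simpa [X, not_le.2 hi] using h1
      · intro b _ hb
        simp [X, not_le.2 hi, hb.symm]
      · simp
    refine ⟨fun i => X⁻¹ i j, hz, fun i hi => hX.inv hXd i j hi, fun k hk => ?_⟩
    have h1 : (X * X⁻¹) k j = if k = j then 1 else 0 := by rw [hXX, one_apply]
    rw [← h1, mul_apply]
    refine Finset.sum_congr rfl fun i _ => ?_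
    by_cases hi : j ≤ i
    · simp [X, hk, hi]
    · simp only [hz i (not_le.1 hi), mul_zero]
  choose c h1 h2 h3 using key
  let q : Matrix (Fin n) (Fin n) K := of fun i j => c j i
  have hq : Pat w q := fun i j hij => h2 j i hij
  have hp : IsN (x * q) := by
    refine ⟨fun i => ?_, fun i j hij => ?_⟩
    · have := h3 i i le_rfl
      simpa [mul_apply, q] using this
    · have := h3 j i hij.le
      simpa [mul_apply, q, hij.ne'] using this
  refine ⟨x * q, q, hp, hx.mul hq, ⟨?_, fun i j hij => h1 j i hij⟩, rfl⟩
  have := hp.isB.1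
  rwa [det_mul, hd, one_mul] at this

/-- Monomial orthogonal matrices. -/
def Mon (w : Equiv.Perm (Fin n)) (W : Matrix (Fin n) (Fin n) K) : Prop :=
  (∀ a b, a ≠ w b → W a b = 0) ∧ Wᵀ * W = 1

variable {w : Equiv.Perm (Fin n)} {W : Matrix (Fin n) (Fin n) K}

lemma Mon.mul_t (h : Mon w W) : W * Wᵀ = 1 := mul_eq_one_comm.1 h.2

lemma Mon.transpose (h : Mon w W) : Mon w⁻¹ Wᵀ := by
  refine ⟨fun a b hab => h.1 b a ?_, by rw [transpose_transpose, h.mul_t]⟩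
  rintro rfl
  simp at hab

lemma Mon.conj (h : Mon w W) (i j : Fin n) :
    (Wᵀ * x * W) i j = W (w i) i * x (w i) (w j) * W (w j) j := by
  rw [mul_apply, Finset.sum_eq_single (w j), mul_apply, Finset.sum_eq_single (w i)]
  · rfl
  · intro b _ hb; rw [transpose_apply, h.1 _ _ hb, zero_mul]
  · simp
  · intro b _ hb; rw [h.1 _ _ hb, mul_zero]
  · simp

lemma Mon.det_conj (h : Mon w W) : (Wᵀ * x * W).det = x.det := by
  rw [det_mul, det_mul, mul_right_comm, ← det_mul, h.2, det_one, one_mul]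

lemma Mon.pat (h : Mon w W) (hx : IsBm x) : Pat w (Wᵀ * x * W) := by
  intro i j hij
  rw [h.conj, hx.2 _ _ hij, mul_zero, zero_mul]

lemma Mon.low (h : Mon w W) (hx : Pat w x) (hd : x.det = 1) : IsBm (W * x * Wᵀ) := by
  have e : W * x * Wᵀ = Wᵀᵀ * x * Wᵀ := by rw [transpose_transpose]
  rw [e]
  refine ⟨by rw [h.transpose.det_conj, hd], fun i j hij => ?_⟩
  rw [h.transpose.conj, hx, mul_zero, zero_mul]
  simpa using hij

lemma IsH.pat (hx : IsH x) : Pat w x :=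
  fun i j hij => hx.2 i j (by rintro rfl; exact lt_irrefl _ hij)

/-- Refined Bruhat decomposition. -/
lemma Mon.refine {g : Matrix (Fin n) (Fin n) K} (h : Mon w W)
    (hA : IsBm A) (hB : IsBm B) (hg : g = A * W * B) :
    ∃ p b, IsN p ∧ Pat w p ∧ IsBm b ∧ g = W * p * b := by
  obtain ⟨p, q, hp, hpp, hq, e⟩ := (h.pat hA).factor (by rw [h.det_conj, hA.1])
  refine ⟨p, q⁻¹ * B, hp, hpp, hq.inv.mul hB, ?_⟩
  have e1 : W * p = A * W * q := by
    rw [← e]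
    simp only [← mul_assoc]
    rw [h.mul_t, one_mul]
  rw [e1, hg, mul_assoc (A * W) q, ← mul_assoc q, hq.mul_inv, one_mul]

lemma pdot_mon (w : Equiv.Perm (Fin n)) : Mon w (pdot w : Matrix (Fin n) (Fin n) K) := by
  refine ⟨fun a b hab => by simp [pdot, hab], ?_⟩
  ext i j
  rw [mul_apply, Finset.sum_eq_single (w j)]
  · by_cases hij : i = j
    · subst hij
      simp [pdot, ← pow_add, ← two_mul]
    · rw [one_apply_ne hij]
      have : w j ≠ w i := fun h => hij (w.injective h).symm
      simp [pdot, this]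
  · intro b _ hb
    simp [pdot, hb]
  · simp

lemma Mon.inv_eq (h : Mon w W) : W⁻¹ = Wᵀ := inv_eq_left_inv h.2

end helpers

theorem half1 {v w : Equiv.Perm (Fin n)} {V W g : Matrix (Fin n) (Fin n) K}
    (hV : Mon v V) (hW : Mon w W)
    (hg : ∃ b₁ b₂, IsBm b₁ ∧ IsBm b₂ ∧ g = b₁ * W * b₂) (hN : IsN (g * Vᵀ)) :
    (∃ a b c, UDL (gᵀ * W) a b c) ∧
      ∀ a b c, UDL (gᵀ * W) a b c →
        (∃ b₁ b₂, IsBm b₁ ∧ IsBm b₂ ∧ V * a = b₁ * W * b₂) ∧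
        IsN (Vᵀ * (V * a)) ∧
        (∃ d e f, LDU (W * (V * a)ᵀ) d e f) ∧
        ∀ d e f, LDU (W * (V * a)ᵀ) d e f → f * V = g := by
  obtain ⟨b₁, b₂, hb₁, hb₂, hg⟩ := hg
  obtain ⟨p, b', hp, hpp, hb', e⟩ := hW.refine hb₁ hb₂ hg
  have e1 : gᵀ * W = b'ᵀ * pᵀ := by
    rw [e, transpose_mul, transpose_mul, mul_assoc, mul_assoc, hW.2, mul_one]
  obtain ⟨u, hu⟩ : ∃ u, u = g * Vᵀ := ⟨_, rfl⟩
  rw [← hu] at hN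
  have hgu : u * V = g := by rw [hu, mul_assoc, hV.2, mul_one]
  refine ⟨?_, fun a b c habc => ?_⟩
  · obtain ⟨a, b, ha, hb, e2⟩ := exists_UD hb'.transpose
    exact ⟨a, b, pᵀ, ha, hb, hp.transpose, by rw [e1, e2]⟩
  obtain ⟨ha, hb, hc, e2⟩ := habc
  have hcp : cᵀ = p := by
    refine uniq_left (P := (a * b)ᵀ) (Q := b') (ha.isB.mul hb.isB).transpose hb' hc.transpose hp ?_
    rw [← transpose_mul, ← e2, e1, transpose_mul, transpose_transpose, transpose_transpose]
  obtain ⟨r, hr⟩ : ∃ r, r = b * c := ⟨_, rfl⟩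
  have hrB : IsBm r := hr ▸ hb.isBm.mul hc.isBm
  have hrP : Pat w rᵀ := by
    rw [hr, transpose_mul, hcp]
    exact hpp.mul hb.transpose.pat
  have hrT : IsUnit (rᵀ).det := by rw [det_transpose, hrB.1]; exact isUnit_one
  have e3 : V * a * r = uᵀ * W := by
    rw [hr, mul_assoc V, ← mul_assoc a, ← e2, ← hgu, transpose_mul, ← mul_assoc, ← mul_assoc,
      hV.mul_t, one_mul]
  have e4 : V * a = uᵀ * W * r⁻¹ := by
    rw [← e3, mul_assoc, hrB.mul_inv, mul_one]
  have hL : IsBm (W * (rᵀ)⁻¹ * Wᵀ) := by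
    refine hW.low (hrP.inv hrT) ?_
    rw [← transpose_nonsing_inv, det_transpose, hrB.inv.1]
  have e5 : W * (V * a)ᵀ = W * (rᵀ)⁻¹ * Wᵀ * u := by
    rw [e4, transpose_mul, transpose_mul, transpose_transpose, transpose_nonsing_inv]
    simp only [mul_assoc]
  refine ⟨⟨uᵀ, r⁻¹, hN.isB.transpose, hrB.inv, e4⟩, ?_, ?_, ?_⟩
  · rw [← mul_assoc, hV.2, one_mul]; exact ha
  · obtain ⟨d, e, hd, he, e6⟩ := exists_LD hL
    exact ⟨d, e, u, hd, he, hN, by rw [e5, e6]⟩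
  · rintro d e f ⟨hd, he, hf, e6⟩
    have : f = u := uniq_right (hd.isBm.mul he.isBm) hL hf hN (by rw [← e6, e5])
    rw [this, hgu]

lemma Mon.refine2 {w : Equiv.Perm (Fin n)} {A B W g : Matrix (Fin n) (Fin n) K} (h : Mon w W)
    (hA : IsBm A) (hB : IsBm B) (hg : g = A * W * B) :
    ∃ p b, IsN p ∧ Pat w⁻¹ p ∧ IsBm b ∧ g = b * p * W := by
  obtain ⟨p, b, hp, hpp, hb, e⟩ := h.transpose.refine hB.inv hA.inv rfl
  refine ⟨p⁻¹, b⁻¹, hp.inv, hpp.inv (by rw [hp.isB.1]; exact isUnit_one), hb.inv, ?_⟩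
  have h1 : g * (B⁻¹ * Wᵀ * A⁻¹) = 1 := by
    rw [hg]
    calc A * W * B * (B⁻¹ * Wᵀ * A⁻¹) = A * (W * (B * B⁻¹) * Wᵀ) * A⁻¹ := by
          simp only [mul_assoc]
      _ = 1 := by rw [hB.mul_inv, mul_one, h.mul_t, mul_one, hA.mul_inv]
  have h2 : (B⁻¹ * Wᵀ * A⁻¹) * (b⁻¹ * p⁻¹ * W) = 1 := by
    rw [e]
    calc Wᵀ * p * b * (b⁻¹ * p⁻¹ * W) = Wᵀ * (p * (b * b⁻¹) * p⁻¹) * W := by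
          simp only [mul_assoc]
      _ = 1 := by rw [hb.mul_inv, mul_one, hp.isB.mul_inv, mul_one, h.2]
  exact left_inv_eq_right_inv h1 h2

theorem half2 {v w : Equiv.Perm (Fin n)} {V W h : Matrix (Fin n) (Fin n) K}
    (hV : Mon v V) (hW : Mon w W)
    (hh : ∃ b₁ b₂, IsBm b₁ ∧ IsBm b₂ ∧ h = b₁ * W * b₂) (hN : IsN (Vᵀ * h)) :
    (∃ d e f, LDU (W * hᵀ) d e f) ∧
      ∀ d e f, LDU (W * hᵀ) d e f →
        (∃ b₁ b₂, IsBm b₁ ∧ IsBm b₂ ∧ f * V = b₁ * W * b₂) ∧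
        IsN ((f * V) * Vᵀ) ∧
        (∃ a b c, UDL ((f * V)ᵀ * W) a b c) ∧
        ∀ a b c, UDL ((f * V)ᵀ * W) a b c → V * a = h := by
  obtain ⟨b₁, b₂, hb₁, hb₂, hh⟩ := hh
  obtain ⟨p, b', hp, hpp, hb', e⟩ := hW.refine2 hb₁ hb₂ hh
  have e1 : W * hᵀ = pᵀ * b'ᵀ := by
    rw [e, transpose_mul, transpose_mul, ← mul_assoc, hW.mul_t, one_mul]
  obtain ⟨u, hu⟩ : ∃ u, u = Vᵀ * h := ⟨_, rfl⟩
  rw [← hu] at hN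
  have hgu : V * u = h := by rw [hu, ← mul_assoc, hV.mul_t, one_mul]
  refine ⟨?_, fun d b f hdbf => ?_⟩
  · obtain ⟨b, f, hb, hf, e2⟩ := exists_DU hb'.transpose
    exact ⟨pᵀ, b, f, hp.transpose, hb, hf, by rw [e1, e2, mul_assoc]⟩
  obtain ⟨hd, hb, hf, e2⟩ := hdbf
  have hdp : dᵀ = p := by
    refine uniq_right (P := (b * f)ᵀ) (Q := b') (hb.isB.mul hf.isB).transpose hb' hd.transpose hp ?_
    rw [← transpose_mul, ← mul_assoc, ← e2, e1, transpose_mul, transpose_transpose,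
      transpose_transpose]
  obtain ⟨r, hr⟩ : ∃ r, r = d * b := ⟨_, rfl⟩
  have hrB : IsBm r := hr ▸ hd.isBm.mul hb.isBm
  have hrP : Pat w⁻¹ rᵀ := by
    rw [hr, transpose_mul, hdp]
    exact hb.transpose.pat.mul hpp
  have hrT : IsUnit (rᵀ).det := by rw [det_transpose, hrB.1]; exact isUnit_one
  have e3 : r * (f * V) = W * uᵀ := by
    rw [hr, ← mul_assoc, ← e2, ← hgu, transpose_mul, mul_assoc, mul_assoc, hV.2, mul_one]
  have e4 : f * V = r⁻¹ * W * uᵀ := by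
    rw [mul_assoc, ← e3, ← mul_assoc, hrB.inv_mul, one_mul]
  have hL : IsBm (Wᵀ * (rᵀ)⁻¹ * W) := by
    have := hW.transpose.low (hrP.inv hrT)
      (by rw [← transpose_nonsing_inv, det_transpose, hrB.inv.1])
    rwa [transpose_transpose] at this
  have e5 : (f * V)ᵀ * W = u * (Wᵀ * (rᵀ)⁻¹ * W) := by
    rw [e4, transpose_mul, transpose_mul, transpose_transpose, transpose_nonsing_inv]
    simp only [mul_assoc]
  refine ⟨⟨r⁻¹, uᵀ, hrB.inv, hN.isB.transpose, e4⟩, ?_, ?_, ?_⟩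
  · rw [mul_assoc, hV.mul_t, mul_one]; exact hf
  · obtain ⟨d, e, hd, he, e6⟩ := exists_DL hL
    exact ⟨u, d, e, hN, hd, he, by rw [e5, e6, mul_assoc]⟩
  · rintro a y c ⟨ha, hy, hc, e6⟩
    have : a = u := uniq_left (hy.isBm.mul hc.isBm) hL ha hN (by rw [← mul_assoc, ← e6, e5])
    rw [this, hgu]

/-- the right pre-twist bijection between `B₋wB₋ ∩ Nv̇` and `B₋wB₋ ∩ v̇N`. -/
theorem statement_1 {n : ℕ} (hn : 1 ≤ n) (v w : Equiv.Perm (Fin n))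
    (g : Matrix (Fin n) (Fin n) ℂ) (hdet : g.det = 1)
    (hBwB : InBmWBm w g)
    (hN : IsN (g * (pdot v : Matrix (Fin n) (Fin n) ℂ)⁻¹)) :
    ((∃ a b c, UDL (gᵀ * pdot w) a b c) ∧
      ∀ a b c, UDL (gᵀ * pdot w) a b c →
        InBmWBm w (pdot v * a) ∧
        IsN ((pdot v : Matrix (Fin n) (Fin n) ℂ)⁻¹ * (pdot v * a)) ∧
        (∃ d e f, LDU (pdot w * (pdot v * a)ᵀ) d e f) ∧
        ∀ d e f, LDU (pdot w * (pdot v * a)ᵀ) d e f → f * pdot v = g) ∧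
    ∀ h : Matrix (Fin n) (Fin n) ℂ, h.det = 1 → InBmWBm w h →
      IsN ((pdot v : Matrix (Fin n) (Fin n) ℂ)⁻¹ * h) →
      (∃ d e f, LDU (pdot w * hᵀ) d e f) ∧
      ∀ d e f, LDU (pdot w * hᵀ) d e f →
        InBmWBm w (f * pdot v) ∧
        IsN ((f * pdot v) * (pdot v : Matrix (Fin n) (Fin n) ℂ)⁻¹) ∧
        (∃ a b c, UDL ((f * pdot v)ᵀ * pdot w) a b c) ∧
        ∀ a b c, UDL ((f * pdot v)ᵀ * pdot w) a b c → pdot v * a = h := by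
  have hV := pdot_mon (K := ℂ) v
  have hW := pdot_mon (K := ℂ) w
  rw [hV.inv_eq] at hN ⊢
  exact ⟨half1 hV hW hBwB hN, fun h _ h2 h3 => half2 hV hW h2 h3⟩

end
end Paper
end

section
/- Let v, w be permutations of {1,…,n} and let g₁, g₂ ∈ SL(n,ℂ) satisfy g_i ∈ B₋wB₋ and g_i·v̇⁻¹ ∈ N for i = 1, 2, and suppose that g₂ = g₁·b for some b ∈ B₋. Then each g_iᵀ·ẇ admits a UDL factorization, and the matrices h_i := v̇·[g_iᵀẇ]_L^+ satisfy h₂ = b₋·h₁ for some b₋ ∈ B₋. -/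
open Matrix Finset

namespace Paper

open scoped Classical

noncomputable section

variable {K : Type*} [Field K] {n m : ℕ}

theorem exists_UL : ∀ (n : ℕ) (M : Matrix (Fin n) (Fin n) K) (σ : Fin n → ℕ),
    Function.Injective σ → (∀ i j, σ j < σ i → M i j = 0) → (∀ i, M i i ≠ 0) →
    ∃ U L : Matrix (Fin n) (Fin n) K, IsN U ∧ (∀ i j, i < j → L i j = 0) ∧ M = U * L := by
  intro n
  induction n with
  | zero =>
    intro M σ _ _ _
    exact ⟨1, 1, ⟨fun i => i.elim0, fun i => i.elim0⟩, fun i => i.elim0, by ext i; exact i.elim0⟩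
  | succ n ih =>
    intro M σ hσ hM hd
    have key : ∀ i j : Fin n, σ j.castSucc ≤ σ i.castSucc →
        M i.castSucc (Fin.last n) * M (Fin.last n) j.castSucc = 0 := by
      intro i j h
      by_cases h1 : σ (Fin.last n) < σ i.castSucc
      · rw [hM _ _ h1, zero_mul]
      · have h2 : σ j.castSucc ≠ σ (Fin.last n) := fun h => (Fin.castSucc_lt_last j).ne (hσ h)
        rw [hM (Fin.last n) j.castSucc (by omega), mul_zero]
    obtain ⟨U, L, hU, hL, hS⟩ := ih
      (Matrix.of fun i j => M i.castSucc j.castSucc -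
        M i.castSucc (Fin.last n) * M (Fin.last n) j.castSucc / M (Fin.last n) (Fin.last n))
      (fun i => σ i.castSucc) (fun i j h => Fin.castSucc_injective n (hσ h))
      (fun i j h => by simp [hM _ _ h, key i j h.le])
      (fun i => by simpa [key i i le_rfl] using hd i.castSucc)
    refine ⟨Matrix.of fun i j => Fin.lastCases (motive := fun _ => K)
        (Fin.lastCases (motive := fun _ => K) 1 (fun _ => 0) j)
        (fun i => Fin.lastCases (motive := fun _ => K)
          (M i.castSucc (Fin.last n) / M (Fin.last n) (Fin.last n)) (fun j => U i j) j) i,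
      Matrix.of fun i j => Fin.lastCases (motive := fun _ => K) (M (Fin.last n) j)
        (fun i => Fin.lastCases (motive := fun _ => K) 0 (fun j => L i j) j) i, ⟨?_, ?_⟩, ?_, ?_⟩
    · intro i
      cases i using Fin.lastCases <;> simp [hU.1]
    · intro i j h
      cases i using Fin.lastCases <;> cases j using Fin.lastCases
      · simp at h
      · simp
      · exact absurd h (Fin.castSucc_lt_last _).not_gt
      · simpa using hU.2 _ _ (by simpa using h)
    · intro i j h
      cases i using Fin.lastCases <;> cases j using Fin.lastCases
      · simp at h
      · exact absurd h (Fin.castSucc_lt_last _).not_gt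
      · simp
      · simpa using hL _ _ (by simpa using h)
    · have hd' := hd (Fin.last n)
      ext i j
      rw [Matrix.mul_apply, Fin.sum_univ_castSucc]
      cases i using Fin.lastCases <;> cases j using Fin.lastCases
      · simp
      · simp
      · simp [hd']
      · rename_i i j
        have := congrFun (congrFun hS i) j
        simp only [Matrix.of_apply, Matrix.mul_apply] at this
        simp only [Matrix.of_apply, Fin.lastCases_castSucc, Fin.lastCases_last, ← this]
        field_simp
        ring

theorem upper_mul {A B : Matrix (Fin n) (Fin n) K} (hA : ∀ i j : Fin n, j < i → A i j = 0)
    (hB : ∀ i j : Fin n, j < i → B i j = 0) :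
    (∀ i, (A * B) i i = A i i * B i i) ∧ ∀ i j : Fin n, j < i → (A * B) i j = 0 := by
  constructor
  · intro i
    rw [Matrix.mul_apply, Finset.sum_eq_single i]
    · intro k _ hk
      rcases lt_or_gt_of_ne hk with h | h
      · rw [hA _ _ h, zero_mul]
      · rw [hB _ _ h, mul_zero]
    · simp
  · intro i j h
    rw [Matrix.mul_apply]
    refine Finset.sum_eq_zero fun k _ => ?_
    by_cases hk : k < i
    · rw [hA _ _ hk, zero_mul]
    · rw [hB _ _ (by omega), mul_zero]

theorem lower_mul {A B : Matrix (Fin n) (Fin n) K} (hA : ∀ i j : Fin n, i < j → A i j = 0)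
    (hB : ∀ i j : Fin n, i < j → B i j = 0) :
    ∀ i j : Fin n, i < j → (A * B) i j = 0 := by
  intro i j h
  rw [Matrix.mul_apply]
  refine Finset.sum_eq_zero fun k _ => ?_
  by_cases hk : i < k
  · rw [hA _ _ hk, zero_mul]
  · rw [hB _ _ (by omega), mul_zero]

theorem upper_inv {A : Matrix (Fin n) (Fin n) K} (hA : ∀ i j : Fin n, j < i → A i j = 0)
    (hd : IsUnit A.det) : ∀ i j : Fin n, j < i → A⁻¹ i j = 0 := by
  let _ := A.invertibleOfIsUnitDet hd
  have h : A.BlockTriangular id := fun i j h => hA i j h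
  exact fun i j hij => blockTriangular_inv_of_blockTriangular h hij

theorem lower_inv {A : Matrix (Fin n) (Fin n) K} (hA : ∀ i j : Fin n, i < j → A i j = 0)
    (hd : IsUnit A.det) : ∀ i j : Fin n, i < j → A⁻¹ i j = 0 := by
  intro i j h
  have := upper_inv (A := Aᵀ) (fun i j h => hA j i h) (by simpa using hd) j i h
  rwa [← Matrix.transpose_nonsing_inv] at this

theorem upper_det {A : Matrix (Fin n) (Fin n) K} (hA : ∀ i j : Fin n, j < i → A i j = 0) :
    A.det = ∏ i, A i i := Matrix.det_of_isUpperTriangular (fun i j h => hA i j h)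

theorem lower_det {A : Matrix (Fin n) (Fin n) K} (hA : ∀ i j : Fin n, i < j → A i j = 0) :
    A.det = ∏ i, A i i := by
  rw [← Matrix.det_transpose, upper_det (A := Aᵀ) (fun i j h => hA j i h)]; rfl

theorem lower_diag {A : Matrix (Fin n) (Fin n) K} (hA : ∀ i j : Fin n, i < j → A i j = 0)
    (hd : A.det = 1) (i : Fin n) : A i i ≠ 0 := by
  rw [lower_det hA] at hd
  exact (Finset.prod_ne_zero_iff (f := fun i => A i i)).1 (by rw [hd]; exact one_ne_zero) i (Finset.mem_univ i)

theorem IsN.det {A : Matrix (Fin n) (Fin n) K} (h : IsN A) : A.det = 1 := by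
  rw [upper_det h.2]; simp [h.1]

theorem IsNm.det {A : Matrix (Fin n) (Fin n) K} (h : IsNm A) : A.det = 1 := by
  rw [lower_det h.2]; simp [h.1]

theorem pdot_conj (v : Equiv.Perm (Fin n)) : ∃ s : Fin n → K, (∀ i, s i * s i = 1) ∧
    ∀ (A : Matrix (Fin n) (Fin n) K) (i j : Fin n),
      ((pdot v)ᵀ * A * pdot v : Matrix (Fin n) (Fin n) K) i j = s i * s j * A (v i) (v j) := by
  refine ⟨fun b => (-1 : K) ^ (univ.filter fun k : Fin n => b < k ∧ v k < v b).card, ?_, ?_⟩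
  · intro i
    rw [← mul_pow]; simp
  · intro A i j
    simp only [Matrix.mul_apply, Matrix.transpose_apply, pdot, Matrix.of_apply, ite_mul, mul_ite,
      zero_mul, mul_zero, Finset.sum_ite_eq', Finset.mem_univ, if_true]
    ring

theorem pdot_orth (v : Equiv.Perm (Fin n)) :
    (pdot v : Matrix (Fin n) (Fin n) K)ᵀ * pdot v = 1 := by
  obtain ⟨s, hs, h⟩ := pdot_conj (K := K) v
  ext i j
  have := h 1 i j
  rw [Matrix.mul_one] at this
  rw [this]
  by_cases hij : i = j
  · subst hij; simp [hs]
  · simp [Matrix.one_apply, hij]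

theorem exists_UDL (w : Equiv.Perm (Fin n)) (g : Matrix (Fin n) (Fin n) K) (hdet : g.det = 1)
    (hB : InBmWBm w g) : ∃ a b' c, UDL (gᵀ * pdot w) a b' c := by
  obtain ⟨b₁, b₂, h1, h2, hg⟩ := hB
  have hw : (pdot w : Matrix (Fin n) (Fin n) K).det = 1 := by
    rw [hg] at hdet
    simpa [h1.1, h2.1] using hdet
  obtain ⟨s, hs, hc⟩ := pdot_conj (K := K) w
  have hs0 : ∀ i, s i ≠ 0 := fun i h => by simpa [h] using hs i
  have hb1 : ∀ i, b₁ i i ≠ 0 := lower_diag h1.2 h1.1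
  obtain ⟨U, L, hU, hL, hM⟩ := exists_UL n ((pdot w)ᵀ * b₁ᵀ * pdot w) (fun i => (w i : ℕ))
    (fun i j h => w.injective (Fin.ext h))
    (fun i j h => by rw [hc, Matrix.transpose_apply, h1.2 _ _ h, mul_zero])
    (fun i => by rw [hc, hs, one_mul]; exact hb1 _)
  have hdL : L.det = 1 := by
    have := congrArg Matrix.det hM
    simpa [h1.1, hw, hU.det] using this.symm
  have hL0 : ∀ i, L i i ≠ 0 := lower_diag hL hdL
  have hT := upper_mul (A := b₂ᵀ) (B := U) (fun i j h => h2.2 j i h) hU.2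
  have hb2 : ∀ i, b₂ i i ≠ 0 := lower_diag h2.2 h2.1
  refine ⟨Matrix.of fun i j => (b₂ᵀ * U) i j / b₂ j j,
    Matrix.diagonal fun i => b₂ i i * L i i, Matrix.of fun i j => L i j / L i i,
    ⟨?_, ?_⟩, ⟨?_, ?_⟩, ⟨?_, ?_⟩, ?_⟩
  · intro i
    simp [hT.1, hU.1, hb2]
  · intro i j h
    simp [hT.2 i j h]
  · rw [Matrix.det_diagonal, Finset.prod_mul_distrib, ← lower_det h2.2, ← lower_det hL, h2.1, hdL,
      one_mul]
  · intro i j h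
    simp [h]
  · intro i
    simp [hL0]
  · intro i j h
    simp [hL i j h]
  · have e : gᵀ * pdot w = (b₂ᵀ * U) * L := by
      rw [hg, Matrix.mul_assoc b₂ᵀ, ← hM]
      simp only [Matrix.transpose_mul, Matrix.mul_assoc]
    rw [e]
    ext i j
    rw [Matrix.mul_apply (M := b₂ᵀ * U), Matrix.mul_apply]
    refine Finset.sum_congr rfl fun k _ => ?_
    rw [Matrix.mul_diagonal, Matrix.of_apply, Matrix.of_apply]
    have := hb2 k
    have := hL0 k
    field_simp

/-- the right pre-twist is well defined on `Rich_v^w`. -/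
theorem statement_2 {n : ℕ} (hn : 1 ≤ n) (v w : Equiv.Perm (Fin n))
    (g₁ g₂ : Matrix (Fin n) (Fin n) ℂ) (hdet₁ : g₁.det = 1) (hdet₂ : g₂.det = 1)
    (hB₁ : InBmWBm w g₁) (hB₂ : InBmWBm w g₂)
    (hN₁ : IsN (g₁ * (pdot v : Matrix (Fin n) (Fin n) ℂ)⁻¹))
    (hN₂ : IsN (g₂ * (pdot v : Matrix (Fin n) (Fin n) ℂ)⁻¹))
    (b : Matrix (Fin n) (Fin n) ℂ) (hb : IsBm b) (hg : g₂ = g₁ * b) :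
    (∃ a b' c, UDL (g₁ᵀ * pdot w) a b' c) ∧
    (∃ a b' c, UDL (g₂ᵀ * pdot w) a b' c) ∧
    ∀ a₁ b₁ c₁ a₂ b₂ c₂, UDL (g₁ᵀ * pdot w) a₁ b₁ c₁ → UDL (g₂ᵀ * pdot w) a₂ b₂ c₂ →
      ∃ bm, IsBm bm ∧ pdot v * a₂ = bm * (pdot v * a₁) := by
  refine ⟨exists_UDL w g₁ hdet₁ hB₁, exists_UDL w g₂ hdet₂ hB₂, ?_⟩
  intro a₁ b₁ c₁ a₂ b₂ c₂ h₁ h₂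
  obtain ⟨ha₁, hb₁, hc₁, e₁⟩ := h₁
  obtain ⟨ha₂, hb₂, hc₂, e₂⟩ := h₂
  have hV := pdot_orth (K := ℂ) v
  have hVi : (pdot v : Matrix (Fin n) (Fin n) ℂ)⁻¹ = (pdot v)ᵀ := Matrix.inv_eq_left_inv hV
  rw [hVi] at hN₁ hN₂
  set V : Matrix (Fin n) (Fin n) ℂ := pdot v with hVdef
  set u₁ := g₁ * Vᵀ with hu₁
  set u₂ := g₂ * Vᵀ with hu₂
  have hu : u₂ = u₁ * (V * b * Vᵀ) := by
    rw [hu₁, hu₂, hg]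
    calc g₁ * b * Vᵀ = g₁ * 1 * b * Vᵀ := by rw [Matrix.mul_one]
      _ = _ := by rw [← hV]; simp only [Matrix.mul_assoc]
  set u := V * b * Vᵀ with hudef
  have hu1d : IsUnit u₁.det := by rw [hN₁.det]; exact isUnit_one
  have hui : u = u₁⁻¹ * u₂ := by rw [hu, Matrix.nonsing_inv_mul_cancel_left _ _ hu1d]
  have huU : ∀ i j : Fin n, j < i → u i j = 0 := by
    rw [hui]; exact (upper_mul (upper_inv hN₁.2 hu1d) hN₂.2).2
  have huN : IsN u := by
    refine ⟨fun i => ?_, huU⟩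
    have := (upper_mul hN₁.2 huU).1 i
    rw [← hu, hN₁.1, hN₂.1, one_mul] at this
    exact this.symm
  have hbu : b = Vᵀ * u * V := by
    rw [hudef]
    calc b = 1 * b * 1 := by simp
      _ = _ := by rw [← hV]; simp only [Matrix.mul_assoc]
  have hbd : ∀ i, b i i = 1 := by
    obtain ⟨s, hs, hc⟩ := pdot_conj (K := ℂ) v
    intro i
    rw [hbu, hVdef, hc, hs, huN.1, one_mul]
  have hT := upper_mul (A := bᵀ) (B := a₁) (fun i j h => hb.2 j i h) ha₁.2
  have hTN : IsN (bᵀ * a₁) := ⟨fun i => by rw [hT.1, Matrix.transpose_apply, hbd, ha₁.1, one_mul], hT.2⟩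
  have hTd : IsUnit (bᵀ * a₁).det := by rw [hTN.det]; exact isUnit_one
  have e : (bᵀ * a₁) * (b₁ * c₁) = a₂ * (b₂ * c₂) := by
    rw [← Matrix.mul_assoc a₂, ← e₂, hg, Matrix.transpose_mul, Matrix.mul_assoc bᵀ g₁ᵀ, e₁]
    simp only [Matrix.mul_assoc]
  have hld : IsUnit (b₂ * c₂).det := by rw [Matrix.det_mul, hb₂.1, hc₂.det]; simp
  have hXU : ∀ i j : Fin n, j < i → ((bᵀ * a₁)⁻¹ * a₂) i j = 0 :=
    (upper_mul (upper_inv hTN.2 hTd) ha₂.2).2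
  have hX : (bᵀ * a₁)⁻¹ * a₂ = (b₁ * c₁) * (b₂ * c₂)⁻¹ := by
    have h3 : b₁ * c₁ = (bᵀ * a₁)⁻¹ * (a₂ * (b₂ * c₂)) := by
      rw [← e, Matrix.nonsing_inv_mul_cancel_left _ _ hTd]
    rw [h3, ← Matrix.mul_assoc, Matrix.mul_nonsing_inv_cancel_right _ _ hld]
  have hXL : ∀ i j : Fin n, i < j → ((bᵀ * a₁)⁻¹ * a₂) i j = 0 := by
    rw [hX]
    exact lower_mul (lower_mul (fun i j h => hb₁.2 i j h.ne) hc₁.2)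
      (lower_inv (lower_mul (fun i j h => hb₂.2 i j h.ne) hc₂.2) hld)
  have ha : (bᵀ * a₁) * ((bᵀ * a₁)⁻¹ * a₂) = a₂ := Matrix.mul_nonsing_inv_cancel_left _ _ hTd
  have hX1 : (bᵀ * a₁)⁻¹ * a₂ = 1 := by
    ext i j
    rcases lt_trichotomy i j with h | h | h
    · rw [hXL i j h, Matrix.one_apply_ne h.ne]
    · subst h
      have := (upper_mul hTN.2 hXU).1 i
      rw [ha, ha₂.1, hTN.1, one_mul] at this
      rw [← this, Matrix.one_apply_eq]
    · rw [hXU i j h, Matrix.one_apply_ne h.ne']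
  rw [hX1, Matrix.mul_one] at ha
  refine ⟨uᵀ, ⟨by rw [Matrix.det_transpose, huN.det], fun i j h => huU j i h⟩, ?_⟩
  rw [← ha, hudef]
  calc V * (bᵀ * a₁) = V * bᵀ * 1 * a₁ := by simp only [Matrix.mul_one, Matrix.mul_assoc]
    _ = _ := by
      rw [← hV]
      simp only [Matrix.transpose_mul, Matrix.transpose_transpose, Matrix.mul_assoc]


end
end Paper
end

section
/- Let v be a permutation of {1,…,n} and let g ∈ SL(n,ℂ) satisfy g·v̇⁻¹ ∈ N. Then there exists a unique matrix x ∈ SL(n,ℂ) such that x ∈ N₋, v̇·x·v̇⁻¹ ∈ N, and v̇⁻¹·(g·x) ∈ N; moreover, for this x one also has (g·x)·v̇⁻¹ ∈ N. -/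
open Matrix Finset

namespace Paper

open scoped Classical

noncomputable section

variable {K : Type*} [Field K] {n m : ℕ}

def psg {n : ℕ} (v : Equiv.Perm (Fin n)) (b : Fin n) : ℂ :=
  (-1 : ℂ) ^ (univ.filter fun k : Fin n => b < k ∧ v k < v b).card

lemma psg_sq {n : ℕ} (v : Equiv.Perm (Fin n)) (b : Fin n) : psg v b * psg v b = 1 := by
  unfold psg
  rw [← mul_pow]; simp

lemma psg_ne {n : ℕ} (v : Equiv.Perm (Fin n)) (b : Fin n) : psg v b ≠ 0 := by
  intro h
  have := psg_sq v b
  simp [h] at this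

lemma pdot_ap {n : ℕ} (v : Equiv.Perm (Fin n)) (a b : Fin n) :
    (pdot v : Matrix (Fin n) (Fin n) ℂ) a b = if a = v b then psg v b else 0 := rfl

lemma pdot_tmul {n : ℕ} (v : Equiv.Perm (Fin n)) :
    (pdot v : Matrix (Fin n) (Fin n) ℂ)ᵀ * pdot v = 1 := by
  ext i j
  simp only [Matrix.mul_apply, Matrix.transpose_apply, pdot_ap]
  rw [Finset.sum_eq_single (v i)]
  · by_cases h : i = j
    · subst h; simp [psg_sq]
    · simp [h]
  · intro b _ hb; simp [hb]
  · simp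

lemma pdot_inv {n : ℕ} (v : Equiv.Perm (Fin n)) :
    (pdot v : Matrix (Fin n) (Fin n) ℂ)⁻¹ = (pdot v)ᵀ :=
  Matrix.inv_eq_left_inv (pdot_tmul v)

lemma pdot_inv_mul {n : ℕ} (v : Equiv.Perm (Fin n)) :
    (pdot v : Matrix (Fin n) (Fin n) ℂ)⁻¹ * pdot v = 1 := by
  rw [pdot_inv, pdot_tmul]

lemma invp_mul_ap {n : ℕ} (v : Equiv.Perm (Fin n)) (A : Matrix (Fin n) (Fin n) ℂ) (i j : Fin n) :
    ((pdot v : Matrix (Fin n) (Fin n) ℂ)⁻¹ * A) i j = psg v i * A (v i) j := by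
  rw [pdot_inv]
  simp only [Matrix.mul_apply, Matrix.transpose_apply, pdot_ap]
  rw [Finset.sum_eq_single (v i)]
  · simp
  · intro b _ hb; simp [hb]
  · simp

lemma mul_p_ap {n : ℕ} (v : Equiv.Perm (Fin n)) (A : Matrix (Fin n) (Fin n) ℂ) (i j : Fin n) :
    (A * (pdot v : Matrix (Fin n) (Fin n) ℂ)) i j = A i (v j) * psg v j := by
  simp only [Matrix.mul_apply, pdot_ap]
  rw [Finset.sum_eq_single (v j)]
  · simp
  · intro b _ hb; simp [hb]
  · simp

lemma mul_invp_ap {n : ℕ} (v : Equiv.Perm (Fin n)) (A : Matrix (Fin n) (Fin n) ℂ) (i j : Fin n) :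
    (A * (pdot v : Matrix (Fin n) (Fin n) ℂ)⁻¹) i (v j) = A i j * psg v j := by
  rw [pdot_inv]
  simp only [Matrix.mul_apply, Matrix.transpose_apply, pdot_ap]
  rw [Finset.sum_eq_single j]
  · simp
  · intro b _ hb; simp [Ne.symm hb]
  · simp

lemma p_mul_ap {n : ℕ} (v : Equiv.Perm (Fin n)) (A : Matrix (Fin n) (Fin n) ℂ) (i j : Fin n) :
    ((pdot v : Matrix (Fin n) (Fin n) ℂ) * A) (v i) j = psg v i * A i j := by
  simp only [Matrix.mul_apply, pdot_ap]
  rw [Finset.sum_eq_single i]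
  · simp
  · intro b _ hb; simp [Ne.symm hb]
  · simp

lemma conj_ap {n : ℕ} (v : Equiv.Perm (Fin n)) (x : Matrix (Fin n) (Fin n) ℂ) (i j : Fin n) :
    ((pdot v : Matrix (Fin n) (Fin n) ℂ) * x * (pdot v : Matrix (Fin n) (Fin n) ℂ)⁻¹) (v i) (v j)
      = psg v i * x i j * psg v j := by
  rw [mul_invp_ap, p_mul_ap]

/-- Conjugation by `v̇` lands in `N` iff unitriangular in the `v`-order. -/
lemma conj_isN {n : ℕ} (v : Equiv.Perm (Fin n)) (x : Matrix (Fin n) (Fin n) ℂ) :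
    IsN ((pdot v : Matrix (Fin n) (Fin n) ℂ) * x * (pdot v : Matrix (Fin n) (Fin n) ℂ)⁻¹) ↔
      (∀ i, x i i = 1) ∧ ∀ i j, v j < v i → x i j = 0 := by
  constructor
  · rintro ⟨h1, h2⟩
    refine ⟨fun i => ?_, fun i j hij => ?_⟩
    · have := h1 (v i)
      rw [conj_ap] at this
      linear_combination this - x i i * psg_sq v i
    · have := h2 (v i) (v j) hij
      rw [conj_ap] at this
      simpa [psg_ne] using this
  · rintro ⟨h1, h2⟩
    refine ⟨fun i => ?_, fun i j hij => ?_⟩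
    · obtain ⟨i, rfl⟩ := v.surjective i
      rw [conj_ap, h1]; simp [psg_sq]
    · obtain ⟨i, rfl⟩ := v.surjective i
      obtain ⟨j, rfl⟩ := v.surjective j
      rw [conj_ap, h2 i j hij]; simp

lemma isN_mul {n : ℕ} {A B : Matrix (Fin n) (Fin n) ℂ} (hA : IsN A) (hB : IsN B) :
    IsN (A * B) := by
  refine ⟨fun i => ?_, fun i j hij => ?_⟩
  · rw [Matrix.mul_apply, Finset.sum_eq_single i]
    · simp [hA.1, hB.1]
    · intro k _ hk
      rcases lt_or_gt_of_ne hk with h | h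
      · simp [hA.2 i k h]
      · simp [hB.2 k i h]
    · simp
  · rw [Matrix.mul_apply]
    refine Finset.sum_eq_zero fun k _ => ?_
    rcases lt_or_ge k i with h | h
    · simp [hA.2 i k h]
    · simp [hB.2 k j (lt_of_lt_of_le hij h)]

lemma wf_v {n : ℕ} (v : Equiv.Perm (Fin n)) : WellFounded (fun a b : Fin n => v b < v a) :=
  InvImage.wf v (wellFounded_gt (α := Fin n))

lemma rec_sol {n : ℕ} (v : Equiv.Perm (Fin n)) (h : Matrix (Fin n) (Fin n) ℂ) (j : Fin n) :
    ∃ f : Fin n → ℂ, ∀ i, f i = if j < i ∧ v i < v j then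
      - h i j - ∑ k, (if v i < v k then h i k * f k else 0) else 0 := by
  let F : (i : Fin n) → ((k : Fin n) → v i < v k → ℂ) → ℂ := fun i f =>
    if j < i ∧ v i < v j then
      - h i j - ∑ k, (if hk : v i < v k then h i k * f k hk else 0) else 0
  refine ⟨(wf_v v).fix F, fun i => ?_⟩
  rw [WellFounded.fix_eq]
  simp only [F, dite_eq_ite]

lemma row_split {n : ℕ} (v : Equiv.Perm (Fin n)) (h : Matrix (Fin n) (Fin n) ℂ)
    (h1 : ∀ i, h i i = 1) (h2 : ∀ i j, v j < v i → h i j = 0) (f : Fin n → ℂ) (i : Fin n) :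
    ∑ k, h i k * f k = f i + ∑ k, (if v i < v k then h i k * f k else 0) := by
  have : ∀ k, h i k * f k = (if k = i then f i else 0) + (if v i < v k then h i k * f k else 0) := by
    intro k
    rcases lt_trichotomy (v k) (v i) with hk | hk | hk
    · have : k ≠ i := by rintro rfl; exact lt_irrefl _ hk
      simp [h2 i k hk, this]
    · have : k = i := v.injective hk
      subst this; simp [h1]
    · have : k ≠ i := by rintro rfl; exact lt_irrefl _ hk
      simp [hk, this]
  rw [Finset.sum_congr rfl fun k _ => this k, Finset.sum_add_distrib]
  simp

lemma exists_x {n : ℕ} (v : Equiv.Perm (Fin n)) (h : Matrix (Fin n) (Fin n) ℂ)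
    (h1 : ∀ i, h i i = 1) (h2 : ∀ i j, v j < v i → h i j = 0) :
    ∃ x : Matrix (Fin n) (Fin n) ℂ, IsNm x ∧
      ((∀ i, x i i = 1) ∧ ∀ i j, v j < v i → x i j = 0) ∧ IsN (h * x) := by
  choose f hf using rec_sol v h
  have hf0 : ∀ j i, ¬ (j < i ∧ v i < v j) → f j i = 0 := fun j i hh => by
    rw [hf, if_neg hh]
  have hmul : ∀ i j, (h * (1 + Matrix.of fun i j => f j i)) i j =
      h i j + (f j i + ∑ k, (if v i < v k then h i k * f j k else 0)) := by
    intro i j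
    rw [mul_add, mul_one, Matrix.add_apply, Matrix.mul_apply, ← row_split v h h1 h2]
    rfl
  have hz : ∀ i j, v j ≤ v i → ∑ k, (if v i < v k then h i k * f j k else 0) = 0 := by
    intro i j hij
    refine Finset.sum_eq_zero fun k _ => ?_
    split_ifs with hk
    · rw [hf0 j k (fun hh => absurd (hij.trans_lt hk) (not_lt.2 hh.2.le)), mul_zero]
    · rfl
  have hx : ∀ i, (1 + Matrix.of fun i j => f j i : Matrix (Fin n) (Fin n) ℂ) i i = 1 := by
    intro i
    simp [hf0 i i]
  refine ⟨1 + Matrix.of fun i j => f j i, ⟨hx, fun i j hij => ?_⟩,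
    ⟨hx, fun i j hij => ?_⟩, fun i => ?_, fun i j hij => ?_⟩
  · rw [Matrix.add_apply, Matrix.one_apply_ne hij.ne, Matrix.of_apply,
      hf0 j i (fun hh => absurd hij (not_lt.2 hh.1.le)), add_zero]
  · have hne : i ≠ j := by rintro rfl; exact lt_irrefl _ hij
    rw [Matrix.add_apply, Matrix.one_apply_ne hne, Matrix.of_apply,
      hf0 j i (fun hh => absurd hij (not_lt.2 hh.2.le)), add_zero]
  · rw [hmul, h1, hz i i le_rfl, hf0 i i (fun hh => lt_irrefl _ hh.1)]; simp
  · rw [hmul]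
    by_cases hv : v i < v j
    · have := hf j i
      rw [if_pos ⟨hij, hv⟩] at this
      linear_combination this
    · have hne : v j ≠ v i := fun e => hij.ne (v.injective e)
      have hlt : v j < v i := lt_of_le_of_ne (not_lt.1 hv) hne
      rw [hz i j hlt.le, h2 i j hlt, hf0 j i (fun hh => hv hh.2)]; simp

lemma unique_x {n : ℕ} (v : Equiv.Perm (Fin n)) (h : Matrix (Fin n) (Fin n) ℂ)
    (h1 : ∀ i, h i i = 1) (h2 : ∀ i j, v j < v i → h i j = 0)
    (x y : Matrix (Fin n) (Fin n) ℂ) (hx : IsNm x) (hy : IsNm y)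
    (hhx : IsN (h * x)) (hhy : IsN (h * y)) : x = y := by
  ext i j
  induction i using (wf_v v).induction with
  | _ i ih =>
    rcases lt_trichotomy i j with hij | rfl | hij
    · rw [hx.2 i j hij, hy.2 i j hij]
    · rw [hx.1, hy.1]
    · have a := hhx.2 i j hij
      have b := hhy.2 i j hij
      rw [Matrix.mul_apply, row_split v h h1 h2 (fun k => x k j)] at a
      rw [Matrix.mul_apply, row_split v h h1 h2 (fun k => y k j)] at b
      have c : ∑ k, (if v i < v k then h i k * x k j else 0) =
          ∑ k, (if v i < v k then h i k * y k j else 0) := by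
        refine Finset.sum_congr rfl fun k _ => ?_
        split_ifs with hk
        · rw [ih k hk]
        · rfl
      linear_combination a - b - c

/-- unique correction of an element of `Nv̇` to an element of `Nv̇ ∩ v̇N`. -/
theorem statement_3 {n : ℕ} (hn : 1 ≤ n) (v : Equiv.Perm (Fin n))
    (g : Matrix (Fin n) (Fin n) ℂ) (hdet : g.det = 1)
    (hN : IsN (g * (pdot v : Matrix (Fin n) (Fin n) ℂ)⁻¹)) :
    (∃! x : Matrix (Fin n) (Fin n) ℂ,
      IsNm x ∧ IsN (pdot v * x * (pdot v : Matrix (Fin n) (Fin n) ℂ)⁻¹) ∧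
        IsN ((pdot v : Matrix (Fin n) (Fin n) ℂ)⁻¹ * (g * x))) ∧
    ∀ x : Matrix (Fin n) (Fin n) ℂ,
      IsNm x → IsN (pdot v * x * (pdot v : Matrix (Fin n) (Fin n) ℂ)⁻¹) →
      IsN ((pdot v : Matrix (Fin n) (Fin n) ℂ)⁻¹ * (g * x)) →
      IsN ((g * x) * (pdot v : Matrix (Fin n) (Fin n) ℂ)⁻¹) := by
  have hpi := pdot_inv_mul v
  have hip : (pdot v : Matrix (Fin n) (Fin n) ℂ) * (pdot v)⁻¹ = 1 := mul_eq_one_comm.1 hpi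
  obtain ⟨h1, h2⟩ := (conj_isN v ((pdot v)⁻¹ * g)).1 (by
    rw [← mul_assoc, hip, one_mul]; exact hN)
  refine ⟨?_, ?_⟩
  · obtain ⟨x, hx, hc, hm⟩ := exists_x v _ h1 h2
    refine ⟨x, ⟨hx, (conj_isN v x).2 hc, by rw [← mul_assoc]; exact hm⟩, ?_⟩
    rintro y ⟨hy, -, hym⟩
    rw [← mul_assoc] at hym
    exact unique_x v _ h1 h2 y x hy hx hym hm
  · intro x _ hc _
    have e : g * x * (pdot v)⁻¹ = (g * (pdot v)⁻¹) * (pdot v * x * (pdot v)⁻¹) := by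
      calc g * x * (pdot v)⁻¹ = g * ((pdot v)⁻¹ * pdot v) * x * (pdot v)⁻¹ := by
            rw [hpi, mul_one]
        _ = _ := by simp only [mul_assoc]
    rw [e]
    exact isN_mul hN hc

end
end Paper
end
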